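/- arXiv:1002.4739 — 3 statements merged into one kernel-verified Lean document; each statement's English description precedes it below -/
import Mathlib

section
/- Let G be a cyclically ℓ-edge-connected cubic graph with at least 2ℓ+2 vertices, let v1v2v3v4 be a path in G, and let G' be obtained from G by splitting off this path (removing v2 and v3 and adding edges v1v4 and v1'v4', where v1' is the third neighbor of v2 and v4' the third neighbor of v3). Then every cyclic ℓ'-edge-cut E(A',B') of G' with ℓ' < ℓ satisfies ℓ' ≥ ℓ−2 and contains neither the edge v1v4 nor the edge v1'v4'. -/
open SimpleGraph
open scoped Classical

universe u

variable {V : Type u}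

/-- `M` is a perfect matching of `G`: a set of edges of `G` such that every
vertex is incident to exactly one edge of `M`. -/
def IsPM (G : SimpleGraph V) (M : Set (Sym2 V)) : Prop :=
  M ⊆ G.edgeSet ∧ ∀ v : V, ∃! e, e ∈ M ∧ v ∈ e

/-- The edge-cut `E(A, Aᶜ)`: edges of `G` with one end in `A` and one end outside. -/
def cutEdges (G : SimpleGraph V) (A : Set V) : Set (Sym2 V) :=
  {e | e ∈ G.edgeSet ∧ ∃ x y, e = s(x, y) ∧ x ∈ A ∧ y ∉ A}

/-- The edge-cut `E(A, Aᶜ)` is cyclic: both sides induce a subgraph with a cycle. -/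
def CyclicCut (G : SimpleGraph V) (A : Set V) : Prop :=
  ¬(G.induce A).IsAcyclic ∧ ¬(G.induce Aᶜ).IsAcyclic

/-- `G` has no cyclic edge-cut of size less than `k`. -/
def CyclicallyEdgeConnected (G : SimpleGraph V) (k : ℕ) : Prop :=
  ∀ A : Set V, CyclicCut G A → k ≤ (cutEdges G A).ncard

/-- Every edge-cut of `G` has at least `k` edges. -/
def EdgeConnectedGe (G : SimpleGraph V) (k : ℕ) : Prop :=
  ∀ A : Set V, A.Nonempty → Aᶜ.Nonempty → k ≤ (cutEdges G A).ncard

/-- `G` is cubic: every vertex has degree three. -/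
def CubicGraph (G : SimpleGraph V) : Prop :=
  ∀ v : V, (G.neighborSet v).ncard = 3

/-- `G` has no bridges. -/
def Bridgeless (G : SimpleGraph V) : Prop :=
  ∀ e ∈ G.edgeSet, ¬G.IsBridge e

/-- `G` is matching-covered: connected and every edge lies in a perfect matching. -/
def MatchingCovered (G : SimpleGraph V) : Prop :=
  G.Connected ∧ ∀ e ∈ G.edgeSet, ∃ M, IsPM G M ∧ e ∈ M

/-- `M` is a matching of the subgraph of `G` induced on `A` which covers exactly the
vertices of `A \ X` (i.e. covers all vertices of `A` except those in `X`). -/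
def IsNearPM (G : SimpleGraph V) (A X : Set V) (M : Set (Sym2 V)) : Prop :=
  (∀ e ∈ M, ∃ x y, e = s(x, y) ∧ G.Adj x y ∧ x ∈ A ∧ y ∈ A) ∧
  (∀ w ∈ A \ X, ∃! e, e ∈ M ∧ w ∈ e) ∧
  (∀ w ∈ X, ∀ e ∈ M, w ∉ e)

/-- `IsTwistedNet G st c`: the subgraph of `G` induced on the vertex set `st` is a
twisted net with corner set `c`.  A 4-cycle is a twisted net whose corners are its
four vertices; and one may join a twisted net and a twisted net (multiplication), or
a twisted net and a single edge (incrementation), by two edges between corners. -/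
inductive IsTwistedNet (G : SimpleGraph V) : Set V → Set V → Prop
  | cyc4 (a b c d : V) (hab : a ≠ b) (hac : a ≠ c) (had : a ≠ d)
      (hbc : b ≠ c) (hbd : b ≠ d) (hcd : c ≠ d)
      (hadj : ∀ x ∈ ({a, b, c, d} : Set V), ∀ y ∈ ({a, b, c, d} : Set V),
        (G.Adj x y ↔ s(x, y) ∈ ({s(a, b), s(b, c), s(c, d), s(d, a)} : Set (Sym2 V)))) :
      IsTwistedNet G {a, b, c, d} {a, b, c, d}
  | incr (st c : Set V) (u u' v v' : V)
      (hprev : IsTwistedNet G st c)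
      (hu : u ∈ c) (hu' : u' ∈ c) (huu' : u ≠ u')
      (hv : v ∉ st) (hv' : v' ∉ st) (hvv' : v ≠ v')
      (hvv'adj : G.Adj v v') (huv : G.Adj u v) (hu'v' : G.Adj u' v')
      (hcross : ∀ x ∈ st, (G.Adj x v ↔ x = u) ∧ (G.Adj x v' ↔ x = u')) :
      IsTwistedNet G (st ∪ {v, v'}) ((c \ {u, u'}) ∪ {v, v'})
  | mult (st₁ c₁ st₂ c₂ : Set V) (u u' v v' : V)
      (h₁ : IsTwistedNet G st₁ c₁) (h₂ : IsTwistedNet G st₂ c₂)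
      (hdisj : st₁ ∩ st₂ = ∅)
      (hu : u ∈ c₁) (hu' : u' ∈ c₁) (huu' : u ≠ u')
      (hv : v ∈ c₂) (hv' : v' ∈ c₂) (hvv' : v ≠ v')
      (huv : G.Adj u v) (hu'v' : G.Adj u' v')
      (hcross : ∀ x ∈ st₁, ∀ y ∈ st₂,
        (G.Adj x y ↔ ((x = u ∧ y = v) ∨ (x = u' ∧ y = v')))) :
      IsTwistedNet G (st₁ ∪ st₂) ((c₁ \ {u, u'}) ∪ (c₂ \ {v, v'}))

/-- The set of (vertex sets of) semiblocks of `G`: inclusion-wise minimal sides of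
2-edge-cuts. -/
def Semiblocks (G : SimpleGraph V) : Set (Set V) :=
  {A | A.Nonempty ∧ (cutEdges G A).ncard = 2 ∧
    ∀ A' ⊆ A, A'.Nonempty → (cutEdges G A').ncard = 2 → A' = A}

/-- The number of semiblocks of `G`; if `G` has no 2-edge-cut, `G` itself is its
unique semiblock, so the number of semiblocks is `1` in this case. -/
noncomputable def numSemiblocks (G : SimpleGraph V) : ℕ :=
  max 1 (Semiblocks G).ncard

/-- The side `B` of a cyclic 4-edge-cut is solid if `G[B]` has no 2-edge-cut with at
least two vertices on each side. -/
def SolidSide (G : SimpleGraph V) (B : Set V) : Prop :=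
  ¬∃ X ⊆ B, 2 ≤ X.ncard ∧ 2 ≤ (B \ X).ncard ∧
      ({e | e ∈ G.edgeSet ∧ ∃ x y, e = s(x, y) ∧ x ∈ X ∧ y ∈ B \ X}).ncard = 2

/-- The subgraph of `G` induced on `A` is a ladder (a `2 × k` grid) whose two ends
(the edges both of whose end-vertices have degree two in the ladder) are `f₁` and `f₂`. -/
def IsLadder (G : SimpleGraph V) (A : Set V) (f₁ f₂ : Sym2 V) : Prop :=
  ∃ (k : ℕ) (x y : Fin (k + 1) → V),
    Function.Injective x ∧ Function.Injective y ∧ (∀ i j, x i ≠ y j) ∧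
    A = Set.range x ∪ Set.range y ∧
    (∀ u ∈ A, ∀ v ∈ A, (G.Adj u v ↔
      ((∃ i, u = x i ∧ v = y i) ∨ (∃ i, u = y i ∧ v = x i) ∨
       (∃ i : Fin k, (u = x i.castSucc ∧ v = x i.succ) ∨ (u = x i.succ ∧ v = x i.castSucc) ∨
         (u = y i.castSucc ∧ v = y i.succ) ∨ (u = y i.succ ∧ v = y i.castSucc))))) ∧
    f₁ = s(x 0, y 0) ∧ f₂ = s(x (Fin.last k), y (Fin.last k))

/-- The subgraph of `G` induced on `A` is a cycle of length four. -/
def Is4Cycle (G : SimpleGraph V) (A : Set V) : Prop :=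
  ∃ a b c d : V, a ≠ b ∧ a ≠ c ∧ a ≠ d ∧ b ≠ c ∧ b ≠ d ∧ c ≠ d ∧
    A = {a, b, c, d} ∧
    G.Adj a b ∧ G.Adj b c ∧ G.Adj c d ∧ G.Adj d a ∧ ¬G.Adj a c ∧ ¬G.Adj b d

/-- The graph `G_{(pq)}` obtained from `G[A]` by adding a new vertex (`Sum.inr 0`)
adjacent to `p` and `q`, a new vertex (`Sum.inr 1`) adjacent to `r` and `t`, and an
edge between the two new vertices. -/
def GExt (G : SimpleGraph V) (A : Set V) (p q r t : V) : SimpleGraph (↥A ⊕ Fin 2) :=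
  SimpleGraph.fromRel (fun x y =>
    (∃ u v : A, x = Sum.inl u ∧ y = Sum.inl v ∧ G.Adj u v) ∨
    (∃ u : A, x = Sum.inr 0 ∧ y = Sum.inl u ∧ ((u : V) = p ∨ (u : V) = q)) ∨
    (∃ u : A, x = Sum.inr 1 ∧ y = Sum.inl u ∧ ((u : V) = r ∨ (u : V) = t)) ∨
    (x = Sum.inr 0 ∧ y = Sum.inr 1))

/-- Perfect matching, as a finite edge set. -/
def IsPMF (G : SimpleGraph V) (M : Finset (Sym2 V)) : Prop :=
  (↑M : Set (Sym2 V)) ⊆ G.edgeSet ∧ ∀ v : V, ∃! e, e ∈ M ∧ v ∈ e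

/-- `w` lies in the perfect matching polytope of `G`: it is a convex combination of
characteristic vectors of perfect matchings of `G`. -/
def InPMPolytope [Fintype V] [DecidableEq V] (G : SimpleGraph V) (w : Sym2 V → ℝ) : Prop :=
  ∃ μ : Finset (Sym2 V) → ℝ,
    (∀ M, 0 ≤ μ M) ∧ (∀ M, μ M ≠ 0 → IsPMF G M) ∧
    (∑ M : Finset (Sym2 V), μ M) = 1 ∧
    ∀ e : Sym2 V, w e = ∑ M : Finset (Sym2 V), μ M * (if e ∈ M then 1 else 0)

/-- `Y` is nonempty and induces a subgraph of `G` of minimum degree at least two. -/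
def IsCore (G : SimpleGraph V) (Y : Set V) : Prop :=
  Y.Nonempty ∧ ∀ y ∈ Y, ∃ a ∈ Y, ∃ b ∈ Y, a ≠ b ∧ G.Adj y a ∧ G.Adj y b

theorem IsCore.not_isAcyclic [Fintype V] {G : SimpleGraph V} {X Y : Set V} (h : IsCore G Y)
    (hYX : Y ⊆ X) : ¬(G.induce X).IsAcyclic := by
  intro hX
  have hY : (G.induce Y).IsAcyclic :=
    hX.comap (G' := G.induce X) (SimpleGraph.induceHomOfLE G hYX).toHom
      (SimpleGraph.induceHomOfLE G hYX).injective
  have : Nonempty Y := h.1.to_subtype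
  obtain ⟨u, v, p, hp, hmax⟩ := Walk.exists_isPath_forall_isPath_length_le_length (G.induce Y)
  obtain ⟨a, ha, b, hb, hab, hua, hub⟩ := h.2 u u.2
  have key : ∀ w : Y, (G.induce Y).Adj u w → w = p.snd := by
    intro w hw
    by_cases hs : w ∈ p.support
    · exact hY.eq_snd_of_adj_start hp hw hs
    · have := hmax _ _ _ (hp.cons (h := hw.symm) hs)
      simp at this
  have h1 := key ⟨a, ha⟩ hua
  have h2 := key ⟨b, hb⟩ hub
  exact hab (congrArg Subtype.val (h1.trans h2.symm))

theorem exists_isCore_of_not_isAcyclic {G : SimpleGraph V} {X : Set V}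
    (h : ¬(G.induce X).IsAcyclic) : ∃ Y ⊆ X, IsCore G Y := by
  simp only [SimpleGraph.IsAcyclic, not_forall, not_not] at h
  obtain ⟨v, p, hp⟩ := h
  refine ⟨{x | ∃ hx : x ∈ X, (⟨x, hx⟩ : X) ∈ p.support}, fun x hx => hx.1, ?_, ?_⟩
  · exact ⟨v, v.2, p.start_mem_support⟩
  · rintro y ⟨hy, hyp⟩
    have h2 := hp.ncard_neighborSet_toSubgraph_eq_two hyp
    obtain ⟨a, b, hab, hs⟩ := Set.ncard_eq_two.1 h2
    have ha : p.toSubgraph.Adj ⟨y, hy⟩ a := by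
      have : a ∈ p.toSubgraph.neighborSet ⟨y, hy⟩ := by rw [hs]; simp
      exact this
    have hb : p.toSubgraph.Adj ⟨y, hy⟩ b := by
      have : b ∈ p.toSubgraph.neighborSet ⟨y, hy⟩ := by rw [hs]; simp
      exact this
    refine ⟨a, ⟨a.2, ?_⟩, b, ⟨b.2, ?_⟩, fun h => hab (Subtype.ext h), ha.adj_sub, hb.adj_sub⟩
    · simpa using p.mem_verts_toSubgraph.1 ha.snd_mem
    · simpa using p.mem_verts_toSubgraph.1 hb.snd_mem

theorem mk_mem_cutEdges {G : SimpleGraph V} {A : Set V} {x y : V} :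
    s(x, y) ∈ cutEdges G A ↔ G.Adj x y ∧ (x ∈ A ↔ y ∉ A) := by
  simp only [cutEdges, Set.mem_ofPred_eq, SimpleGraph.mem_edgeSet, Sym2.eq_iff]
  constructor
  · rintro ⟨h, a, b, (⟨rfl, rfl⟩ | ⟨rfl, rfl⟩), h1, h2⟩ <;> tauto
  · rintro ⟨h, h'⟩
    refine ⟨h, ?_⟩
    by_cases hx : x ∈ A
    · exact ⟨x, y, by tauto⟩
    · exact ⟨y, x, by tauto⟩

theorem cutEdges_compl (G : SimpleGraph V) (A : Set V) : cutEdges G Aᶜ = cutEdges G A := by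
  ext e
  induction e with
  | _ x y => simp only [mk_mem_cutEdges, Set.mem_compl_iff]; tauto

theorem exists_neighbors_eq [Fintype V] {G : SimpleGraph V} (hG : CubicGraph G) {v a b : V}
    (ha : G.Adj v a) (hb : G.Adj v b) (hab : a ≠ b) :
    ∃ c, c ≠ a ∧ c ≠ b ∧ ∀ z, G.Adj v z ↔ z = a ∨ z = b ∨ z = c := by
  obtain ⟨x, y, z, hxy, hxz, hyz, hs⟩ := Set.ncard_eq_three.1 (hG v)
  have key : ∀ w, G.Adj v w ↔ w = x ∨ w = y ∨ w = z := by
    intro w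
    rw [← SimpleGraph.mem_neighborSet, hs]; simp
  have h1 := (key a).1 ha
  have h2 := (key b).1 hb
  rcases h1 with rfl | rfl | rfl <;> rcases h2 with rfl | rfl | rfl
  all_goals first
    | exact absurd rfl hab
    | exact ⟨x, by tauto, by tauto, fun w => (key w).trans (by tauto)⟩
    | exact ⟨y, by tauto, by tauto, fun w => (key w).trans (by tauto)⟩
    | exact ⟨z, by tauto, by tauto, fun w => (key w).trans (by tauto)⟩

/-- An edge-cut arising from `C` by discarding `e` and adding at most `f` is no larger. -/
theorem ncard_cutEdges_le_of_exchange_one [Fintype V] {G : SimpleGraph V} {B : Set V}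
    {C : Set (Sym2 V)} {e f : Sym2 V} (he : e ∈ C)
    (h : ∀ x ∈ B, ∀ y ∉ B, G.Adj x y → (s(x, y) ∈ C ∧ s(x, y) ≠ e) ∨ s(x, y) = f) :
    (cutEdges G B).ncard ≤ C.ncard := by
  have hsub : cutEdges G B ⊆ insert f (C \ {e}) := by
    rintro _ ⟨hadj, x, y, rfl, hx, hy⟩
    have := h x hx y hy hadj
    simp only [Set.mem_insert_iff, Set.mem_sdiff, Set.mem_singleton_iff]
    tauto
  have h1 := Set.ncard_le_ncard hsub
  have h2 := Set.ncard_insert_le f (C \ {e})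
  have h3 := Set.ncard_sdiff_singleton_add_one he
  omega

/-- An edge-cut arising from `C` by discarding `e₁` and `e₂` and adding at most `f₁` and `f₂`
is no larger. -/
theorem ncard_cutEdges_le_of_exchange_two [Fintype V] {G : SimpleGraph V} {B : Set V}
    {C : Set (Sym2 V)} {e₁ e₂ f₁ f₂ : Sym2 V} (he₁ : e₁ ∈ C) (he₂ : e₂ ∈ C) (hne : e₁ ≠ e₂)
    (h : ∀ x ∈ B, ∀ y ∉ B, G.Adj x y →
      (s(x, y) ∈ C ∧ s(x, y) ≠ e₁ ∧ s(x, y) ≠ e₂) ∨ s(x, y) = f₁ ∨ s(x, y) = f₂) :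
    (cutEdges G B).ncard ≤ C.ncard := by
  have hsub : cutEdges G B ⊆ insert f₁ (insert f₂ ((C \ {e₁}) \ {e₂})) := by
    rintro _ ⟨hadj, x, y, rfl, hx, hy⟩
    have := h x hx y hy hadj
    simp only [Set.mem_insert_iff, Set.mem_sdiff, Set.mem_singleton_iff]
    tauto
  have h1 := Set.ncard_le_ncard hsub
  have h2 := Set.ncard_insert_le f₁ (insert f₂ ((C \ {e₁}) \ {e₂}))
  have h2' := Set.ncard_insert_le f₂ ((C \ {e₁}) \ {e₂})
  have h3 := Set.ncard_sdiff_singleton_add_one he₁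
  have h4 := Set.ncard_sdiff_singleton_add_one (s := C \ {e₁}) (a := e₂) ⟨he₂, hne.symm⟩
  omega

/-- In a cubic graph, an edge-cut with a nonempty acyclic side `X` has at least `|X| + 2` edges. -/
theorem ncard_add_two_le_of_no_isCore [Fintype V] {G : SimpleGraph V} (hG : CubicGraph G)
    (X : Set V) (hX : X.Nonempty) (hno : ∀ Y ⊆ X, ¬IsCore G Y) :
    X.ncard + 2 ≤ (cutEdges G X).ncard := by
  induction hn : X.ncard generalizing X with
  | zero =>
    rw [Set.ncard_eq_zero] at hn
    exact absurd hn hX.ne_empty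
  | succ n ih =>
    have hc := hno X subset_rfl
    simp only [IsCore, hX, true_and, not_forall] at hc
    obtain ⟨v, hv, hdeg⟩ := hc
    have hthree : ∃ a b c, a ≠ b ∧ a ≠ c ∧ b ≠ c ∧ a ∉ X ∧ b ∉ X ∧
        ∀ w, G.Adj v w ↔ w = a ∨ w = b ∨ w = c := by
      obtain ⟨x, y, z, hxy, hxz, hyz, hs⟩ := Set.ncard_eq_three.1 (hG v)
      have key : ∀ w, G.Adj v w ↔ w = x ∨ w = y ∨ w = z := by
        intro w
        rw [← SimpleGraph.mem_neighborSet, hs]; simp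
      have hx := (key x).2 (by simp)
      have hy := (key y).2 (by simp)
      have hz := (key z).2 (by simp)
      by_cases h1 : x ∈ X
      · refine ⟨y, z, x, by tauto, by tauto, by tauto, fun h => hdeg ⟨x, h1, y, h, by tauto⟩,
          fun h => hdeg ⟨x, h1, z, h, by tauto⟩, fun w => (key w).trans (by tauto)⟩
      · by_cases h2 : y ∈ X
        · exact ⟨x, z, y, by tauto, by tauto, by tauto, h1,
            fun h => hdeg ⟨y, h2, z, h, by tauto⟩, fun w => (key w).trans (by tauto)⟩
        · exact ⟨x, y, z, by tauto, by tauto, by tauto, h1, h2, key⟩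
    obtain ⟨a, b, c, hab, hac, hbc, ha, hb, key⟩ := hthree
    have hva := (key a).2 (by simp)
    have hvb := (key b).2 (by simp)
    have hvc := (key c).2 (by simp)
    have hea : s(v, a) ∈ cutEdges G X := mk_mem_cutEdges.2 ⟨hva, by tauto⟩
    have heb : s(v, b) ∈ cutEdges G X := mk_mem_cutEdges.2 ⟨hvb, by tauto⟩
    have hne : s(v, a) ≠ s(v, b) := fun h => hab (Sym2.congr_right.1 h)
    have h3 := Set.ncard_sdiff_singleton_add_one hea
    have h4 := Set.ncard_sdiff_singleton_add_one (s := cutEdges G X \ {s(v, a)}) (a := s(v, b))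
      ⟨heb, hne.symm⟩
    by_cases hX' : (X \ {v}).Nonempty
    · have hcard := Set.ncard_sdiff_singleton_add_one hv
      have := ih (X \ {v}) hX' (fun Y hY => hno Y (hY.trans Set.sdiff_subset)) (by omega)
      have hsub : cutEdges G (X \ {v}) ⊆
          insert s(v, c) ((cutEdges G X \ {s(v, a)}) \ {s(v, b)}) := by
        rintro _ ⟨hadj, x, y, rfl, hx, hy⟩
        simp only [Set.mem_insert_iff, Set.mem_sdiff, Set.mem_singleton_iff, mk_mem_cutEdges,
          SimpleGraph.mem_edgeSet, Sym2.eq_iff] at *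
        have := key x
        grind [G.adj_comm]
      have h1 := Set.ncard_le_ncard hsub
      have h2 := Set.ncard_insert_le s(v, c) ((cutEdges G X \ {s(v, a)}) \ {s(v, b)})
      omega
    · have hXv : X = {v} := by
        rw [Set.not_nonempty_iff_eq_empty, Set.sdiff_eq_empty] at hX'
        exact Set.Subset.antisymm hX' (by simpa using hv)
      have hec : s(v, c) ∈ (cutEdges G X \ {s(v, a)}) \ {s(v, b)} := by
        refine ⟨⟨mk_mem_cutEdges.2 ⟨hvc, ?_⟩, ?_⟩, ?_⟩
        · subst hXv
          have := hvc.ne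
          simp
          tauto
        · exact fun h => hac (Sym2.congr_right.1 h).symm
        · exact fun h => hbc (Sym2.congr_right.1 h).symm
      have h5 := Set.ncard_sdiff_singleton_add_one hec
      have : n = 0 := by
        rw [hXv, Set.ncard_singleton] at hn
        omega
      omega

/-- `G'` arises from `G` by splitting off the path `v₁v₂v₃v₄`; the remaining neighbors of `v₂`
and `v₃` are `w₁` and `w₄`. -/
structure IsSplitting (G G' : SimpleGraph V) (v₁ v₂ v₃ v₄ w₁ w₄ : V) : Prop where
  ne14 : v₁ ≠ v₄
  ne11 : v₁ ≠ w₁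
  ne44 : v₄ ≠ w₄
  new14 : w₁ ≠ w₄
  ne13 : v₁ ≠ v₃
  new13 : w₁ ≠ v₃
  ne24 : v₄ ≠ v₂
  new24 : w₄ ≠ v₂
  nbr2 : ∀ z, G.Adj v₂ z ↔ z = v₁ ∨ z = v₃ ∨ z = w₁
  nbr3 : ∀ z, G.Adj v₃ z ↔ z = v₄ ∨ z = v₂ ∨ z = w₄
  adj : ∀ x y, G'.Adj x y ↔
    (G.Adj x y ∧ x ≠ v₂ ∧ x ≠ v₃ ∧ y ≠ v₂ ∧ y ≠ v₃) ∨
      ((x = v₁ ∧ y = v₄) ∨ (x = v₄ ∧ y = v₁)) ∨ ((x = w₁ ∧ y = w₄) ∨ (x = w₄ ∧ y = w₁))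

namespace IsSplitting

variable {G G' : SimpleGraph V} {v₁ v₂ v₃ v₄ w₁ w₄ : V}

theorem reverse (h : IsSplitting G G' v₁ v₂ v₃ v₄ w₁ w₄) :
    IsSplitting G G' v₄ v₃ v₂ v₁ w₄ w₁ := by
  obtain ⟨h1, h2, h3, h4, h5, h6, h7, h8, n2, n3, ha⟩ := h
  refine ⟨h1.symm, h3, h2, h4.symm, h7, h8, h5, h6, n3, n2, fun x y => ?_⟩
  rw [ha]; tauto

theorem swap (h : IsSplitting G G' v₁ v₂ v₃ v₄ w₁ w₄) :
    IsSplitting G G' w₁ v₂ v₃ w₄ v₁ v₄ := by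
  obtain ⟨h1, h2, h3, h4, h5, h6, h7, h8, n2, n3, ha⟩ := h
  refine ⟨h4, h2.symm, h3.symm, h1, h6, h5, h8, h7, fun x => ?_, fun x => ?_, fun x y => ?_⟩
  · rw [n2]; tauto
  · rw [n3]; tauto
  · rw [ha]; tauto

theorem ne_middle (h : IsSplitting G G' v₁ v₂ v₃ v₄ w₁ w₄) :
    v₁ ≠ v₂ ∧ v₃ ≠ v₂ ∧ w₁ ≠ v₂ ∧ v₄ ≠ v₃ ∧ w₄ ≠ v₃ := by
  have h1 := (h.nbr2 v₁).2 (by simp)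
  have h2 := (h.nbr2 v₃).2 (by simp)
  have h3 := (h.nbr2 w₁).2 (by simp)
  have h4 := (h.nbr3 v₄).2 (by simp)
  have h5 := (h.nbr3 w₄).2 (by simp)
  exact ⟨h1.ne.symm, h2.ne.symm, h3.ne.symm, h4.ne.symm, h5.ne.symm⟩

/-- A core of `G'` becomes a core of `G` after adding `v₂` and `v₃` if necessary. -/
theorem exists_isCore (h : IsSplitting G G' v₁ v₂ v₃ v₄ w₁ w₄) {Y : Set V} (hY : IsCore G' Y) :
    ∃ Z ⊆ Y ∪ {v₂, v₃}, IsCore G Z := by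
  obtain ⟨m1, m2, m3, m4, m5⟩ := h.ne_middle
  obtain ⟨h1, h2, h3, h4, h5, h6, h7, h8, n2, n3, ha⟩ := h
  by_cases hne : (v₁ ∈ Y ∧ v₄ ∈ Y) ∨ (w₁ ∈ Y ∧ w₄ ∈ Y)
  · have a2 : ∀ z, G.Adj z v₂ ↔ z = v₁ ∨ z = v₃ ∨ z = w₁ := fun z => by rw [G.adj_comm, n2]
    have a3 : ∀ z, G.Adj z v₃ ↔ z = v₄ ∨ z = v₂ ∨ z = w₄ := fun z => by rw [G.adj_comm, n3]
    have u2 : v₂ ∈ Y ∪ {v₂, v₃} := by simp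
    have u3 : v₃ ∈ Y ∪ {v₂, v₃} := by simp
    have uY : ∀ {z}, z ∈ Y → z ∈ Y ∪ {v₂, v₃} := fun hz => Or.inl hz
    refine ⟨Y ∪ {v₂, v₃}, subset_rfl, ⟨v₂, u2⟩, ?_⟩
    rintro y (hy | rfl | rfl)
    · obtain ⟨a, haY, b, hbY, hab, hya, hyb⟩ := hY.2 y hy
      have hrep : ∀ c, G'.Adj y c → (G.Adj y c ∧ c ≠ v₂ ∧ c ≠ v₃) ∨
          (G.Adj y v₂ ∧ ((y = v₁ ∧ c = v₄) ∨ (y = w₁ ∧ c = w₄))) ∨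
          (G.Adj y v₃ ∧ ((y = v₄ ∧ c = v₁) ∨ (y = w₄ ∧ c = w₁))) := by
        intro c hc
        rcases (ha _ _).1 hc with ⟨h, -, -, p, q⟩ | (⟨p, q⟩ | ⟨p, q⟩) | (⟨p, q⟩ | ⟨p, q⟩)
        · exact Or.inl ⟨h, p, q⟩
        · exact Or.inr (Or.inl ⟨(a2 _).2 (Or.inl p), Or.inl ⟨p, q⟩⟩)
        · exact Or.inr (Or.inr ⟨(a3 _).2 (Or.inl p), Or.inl ⟨p, q⟩⟩)
        · exact Or.inr (Or.inl ⟨(a2 _).2 (Or.inr (Or.inr p)), Or.inr ⟨p, q⟩⟩)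
        · exact Or.inr (Or.inr ⟨(a3 _).2 (Or.inr (Or.inr p)), Or.inr ⟨p, q⟩⟩)
      rcases hrep a hya with ⟨p, q⟩ | ⟨p, q⟩ | ⟨p, q⟩ <;>
        rcases hrep b hyb with ⟨r, s⟩ | ⟨r, s⟩ | ⟨r, s⟩
      · exact ⟨a, uY haY, b, uY hbY, hab, p, r⟩
      · exact ⟨a, uY haY, v₂, u2, q.1, p, r⟩
      · exact ⟨a, uY haY, v₃, u3, q.2, p, r⟩
      · exact ⟨b, uY hbY, v₂, u2, s.1, r, p⟩
      · exfalso; clear n2 n3 a2 a3 hrep ha; grind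
      · exact ⟨v₂, u2, v₃, u3, m2.symm, p, r⟩
      · exact ⟨b, uY hbY, v₃, u3, s.2, r, p⟩
      · exact ⟨v₂, u2, v₃, u3, m2.symm, r, p⟩
      · exfalso; clear n2 n3 a2 a3 hrep ha; grind
    · rcases hne with ⟨p, q⟩ | ⟨p, q⟩
      · exact ⟨v₁, uY p, v₃, u3, h5, (n2 _).2 (by simp), (n2 _).2 (by simp)⟩
      · exact ⟨w₁, uY p, v₃, u3, h6, (n2 _).2 (by simp), (n2 _).2 (by simp)⟩
    · rcases hne with ⟨p, q⟩ | ⟨p, q⟩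
      · exact ⟨v₄, uY q, v₂, u2, h7, (n3 _).2 (by simp), (n3 _).2 (by simp)⟩
      · exact ⟨w₄, uY q, v₂, u2, h8, (n3 _).2 (by simp), (n3 _).2 (by simp)⟩
  · refine ⟨Y, Set.subset_union_left, hY.1, ?_⟩
    intro y hy
    obtain ⟨a, haY, b, hbY, hab, hya, hyb⟩ := hY.2 y hy
    rw [ha] at hya hyb
    refine ⟨a, haY, b, hbY, hab, ?_, ?_⟩ <;> grind

theorem isCore_of_no_new_edge (h : IsSplitting G G' v₁ v₂ v₃ v₄ w₁ w₄) {Y : Set V}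
    (hY : IsCore G' Y) (h1 : v₁ ∉ Y ∨ v₄ ∉ Y) (h2 : w₁ ∉ Y ∨ w₄ ∉ Y) : IsCore G Y := by
  refine ⟨hY.1, fun y hy => ?_⟩
  obtain ⟨a, haY, b, hbY, hab, hya, hyb⟩ := hY.2 y hy
  rw [h.adj] at hya hyb
  refine ⟨a, haY, b, hbY, hab, ?_, ?_⟩ <;> grind

end IsSplitting

theorem IsCore.notMem_of_forall_eq {G : SimpleGraph V} {Y : Set V} (hY : IsCore G Y) {v c : V}
    (h : ∀ z ∈ Y, G.Adj v z → z = c) : v ∉ Y := by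
  intro hv
  obtain ⟨a, ha, b, hb, hab, hva, hvb⟩ := hY.2 v hv
  exact hab ((h a ha hva).trans (h b hb hvb).symm)

theorem CyclicallyEdgeConnected.le_of_isCore [Fintype V] {G : SimpleGraph V} {ℓ : ℕ}
    (hG : CyclicallyEdgeConnected G ℓ) {B Y Z : Set V} (hY : IsCore G Y) (hYB : Y ⊆ B)
    (hZ : IsCore G Z) (hZB : ∀ z ∈ Z, z ∉ B) : ℓ ≤ (cutEdges G B).ncard :=
  hG B ⟨hY.not_isAcyclic hYB, hZ.not_isAcyclic hZB⟩

namespace IsSplitting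

variable {G G' : SimpleGraph V} {v₁ v₂ v₃ v₄ w₁ w₄ : V}

theorem notMem_of_isCore (h : IsSplitting G G' v₁ v₂ v₃ v₄ w₁ w₄) {Y : Set V}
    (hY : IsCore G' Y) : v₂ ∉ Y ∧ v₃ ∉ Y := by
  obtain ⟨m1, m2, m3, m4, m5⟩ := h.ne_middle
  have n1 := h.ne13
  have n2 := h.new13
  have n3 := h.ne24
  have n4 := h.new24
  constructor
  · refine hY.notMem_of_forall_eq (c := v₂) fun z _ hz => ?_
    rw [h.adj] at hz
    grind
  · refine hY.notMem_of_forall_eq (c := v₃) fun z _ hz => ?_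
    rw [h.adj] at hz
    grind

/-- The two new edges cannot both cross the cut in the same direction. -/
theorem false_of_parallel [Fintype V] (h : IsSplitting G G' v₁ v₂ v₃ v₄ w₁ w₄)
    (hcubic : CubicGraph G) {ℓ : ℕ} (hG : CyclicallyEdgeConnected G ℓ) {A Y Z : Set V}
    (hY : IsCore G' Y) (hYA : ∀ z ∈ Y, z ∈ A) (hZ : IsCore G' Z) (hZA : ∀ z ∈ Z, z ∉ A)
    (hlt : (cutEdges G' A).ncard < ℓ) (hv₁ : v₁ ∈ A) (hv₄ : v₄ ∉ A) (hw₁ : w₁ ∈ A)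
    (hw₄ : w₄ ∉ A) : False := by
  obtain ⟨m1, m2, m3, m4, m5⟩ := h.ne_middle
  obtain ⟨y2, y3⟩ := h.notMem_of_isCore hY
  obtain ⟨z2, z3⟩ := h.notMem_of_isCore hZ
  have n1 := h.ne13
  have n2 := h.new13
  have n3 := h.ne24
  have n4 := h.new24
  have n11 := h.ne11
  have n44 := h.ne44
  have a21 := (h.nbr2 v₁).2 (by simp)
  have b21 := (h.nbr2 w₁).2 (by simp)
  have a34 := (h.nbr3 v₄).2 (by simp)
  have b34 := (h.nbr3 w₄).2 (by simp)
  have he : s(v₁, v₄) ∈ cutEdges G' A :=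
    mk_mem_cutEdges.2 ⟨(h.adj _ _).2 (by simp), by tauto⟩
  have hf : s(w₁, w₄) ∈ cutEdges G' A :=
    mk_mem_cutEdges.2 ⟨(h.adj _ _).2 (by simp), by tauto⟩
  have hfin : ∀ B Y Z : Set V, IsCore G Y → (∀ z ∈ Y, z ∈ B) → IsCore G Z → (∀ z ∈ Z, z ∉ B) →
      (cutEdges G B).ncard ≤ (cutEdges G' A).ncard → False := fun B Y Z hY hYB hZ hZB hle =>
    absurd (hG.le_of_isCore hY hYB hZ hZB) (by omega)
  have hYG : IsCore G Y := h.isCore_of_no_new_edge hY (Or.inr fun hz => hv₄ (hYA _ hz))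
    (Or.inr fun hz => hw₄ (hYA _ hz))
  have hZG : IsCore G Z := h.isCore_of_no_new_edge hZ (Or.inl fun hz => hZA _ hz hv₁)
    (Or.inl fun hz => hZA _ hz hw₁)
  by_cases hboth : G.Adj v₁ v₄ ∧ G.Adj w₁ w₄
  · obtain ⟨c, -, -, hc⟩ := exists_neighbors_eq hcubic a21.symm hboth.1 n3.symm
    obtain ⟨d, -, -, hd⟩ := exists_neighbors_eq hcubic b21.symm hboth.2 n4.symm
    have hv : v₁ ∉ Y := hY.notMem_of_forall_eq (c := c) fun z hz hadj => by
      have := hYA z hz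
      have := hc z
      rw [h.adj] at hadj
      grind
    have hw : w₁ ∉ Y := hY.notMem_of_forall_eq (c := d) fun z hz hadj => by
      have := hYA z hz
      have := hd z
      rw [h.adj] at hadj
      grind
    refine hfin {z | z ∈ A ∧ z ≠ v₂ ∧ z ≠ v₃ ∧ z ≠ v₁ ∧ z ≠ w₁} Y Z hYG
      (fun z hz => ?_) hZG (fun z hz => ?_)
      (ncard_cutEdges_le_of_exchange_two he hf (by simp only [ne_eq, Sym2.eq_iff]; grind) (f₁ := s(v₁, c)) (f₂ := s(w₁, d)) ?_)
    · have := hYA z hz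
      simp only [Set.mem_ofPred_eq]
      grind
    · have := hZA z hz
      simp only [Set.mem_ofPred_eq]
      grind
    · intro x hx y hy hxy
      simp only [Set.mem_ofPred_eq, mk_mem_cutEdges, h.adj, Sym2.eq_iff] at hx hy ⊢
      have f2 := h.nbr2 x
      have f2' := h.nbr2 y
      have f3 := h.nbr3 x
      have f3' := h.nbr3 y
      have hyx := hxy.symm
      have g1 := hc x
      have g1' := hc y
      have g2 := hd x
      have g2' := hd y
      grind (splits := 30)
  · have hex : ∃ e ∈ cutEdges G' A, e ∉ G.edgeSet := by
      by_cases hv : G.Adj v₁ v₄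
      · exact ⟨s(w₁, w₄), hf, fun hw => hboth ⟨hv, hw⟩⟩
      · exact ⟨s(v₁, v₄), he, hv⟩
    obtain ⟨e, heC, heG⟩ := hex
    refine hfin {z | (z ∈ A ∧ z ≠ v₃) ∨ z = v₂} Y Z hYG
      (fun z hz => ?_) hZG (fun z hz => ?_)
      (ncard_cutEdges_le_of_exchange_one heC (f := s(v₂, v₃)) ?_)
    · have := hYA z hz
      simp only [Set.mem_ofPred_eq]
      grind
    · have := hZA z hz
      simp only [Set.mem_ofPred_eq]
      grind
    · intro x hx y hy hxy
      have hne : s(x, y) ≠ e := fun hh => heG (hh ▸ hxy)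
      simp only [Set.mem_ofPred_eq, mk_mem_cutEdges, h.adj, Sym2.eq_iff] at hx hy ⊢
      have f2 := h.nbr2 x
      have f2' := h.nbr2 y
      have f3 := h.nbr3 x
      have f3' := h.nbr3 y
      have hyx := hxy.symm
      grind (splits := 30)

/-- The two new edges cannot cross the cut in opposite directions. -/
theorem false_of_cross [Fintype V] (h : IsSplitting G G' v₁ v₂ v₃ v₄ w₁ w₄)
    (hcubic : CubicGraph G) {ℓ : ℕ} (hG : CyclicallyEdgeConnected G ℓ) {A Y Z : Set V}
    (hY : IsCore G' Y) (hYA : ∀ z ∈ Y, z ∈ A) (hZ : IsCore G' Z) (hZA : ∀ z ∈ Z, z ∉ A)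
    (hlt : (cutEdges G' A).ncard < ℓ) (hv₁ : v₁ ∈ A) (hv₄ : v₄ ∉ A) (hw₁ : w₁ ∉ A)
    (hw₄ : w₄ ∈ A) : False := by
  obtain ⟨m1, m2, m3, m4, m5⟩ := h.ne_middle
  obtain ⟨y2, y3⟩ := h.notMem_of_isCore hY
  obtain ⟨z2, z3⟩ := h.notMem_of_isCore hZ
  have n1 := h.ne13
  have n2 := h.new13
  have n3 := h.ne24
  have n4 := h.new24
  have n11 := h.ne11
  have n44 := h.ne44
  have a21 := (h.nbr2 v₁).2 (by simp)
  have b21 := (h.nbr2 w₁).2 (by simp)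
  have a34 := (h.nbr3 v₄).2 (by simp)
  have b34 := (h.nbr3 w₄).2 (by simp)
  have he : s(v₁, v₄) ∈ cutEdges G' A :=
    mk_mem_cutEdges.2 ⟨(h.adj _ _).2 (by simp), by tauto⟩
  have hf : s(w₁, w₄) ∈ cutEdges G' A :=
    mk_mem_cutEdges.2 ⟨(h.adj _ _).2 (by simp), by tauto⟩
  have hfin : ∀ B Y Z : Set V, IsCore G Y → (∀ z ∈ Y, z ∈ B) → IsCore G Z → (∀ z ∈ Z, z ∉ B) →
      (cutEdges G B).ncard ≤ (cutEdges G' A).ncard → False := fun B Y Z hY hYB hZ hZB hle =>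
    absurd (hG.le_of_isCore hY hYB hZ hZB) (by omega)
  have hYG : IsCore G Y := h.isCore_of_no_new_edge hY (Or.inr fun hz => hv₄ (hYA _ hz))
    (Or.inl fun hz => hw₁ (hYA _ hz))
  have hZG : IsCore G Z := h.isCore_of_no_new_edge hZ (Or.inl fun hz => hZA _ hz hv₁)
    (Or.inr fun hz => hZA _ hz hw₄)
  have hleaf : ∀ c, (∀ z, G.Adj v₁ z ↔ z = v₂ ∨ z = v₄ ∨ z = c) → v₁ ∉ Y := fun c hc =>
    hY.notMem_of_forall_eq (c := c) fun z hz hadj => by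
      have := hYA z hz
      have := hc z
      rw [h.adj] at hadj
      grind
  have hleaf' : ∀ c, (∀ z, G.Adj w₄ z ↔ z = v₃ ∨ z = w₁ ∨ z = c) → w₄ ∉ Y := fun c hc =>
    hY.notMem_of_forall_eq (c := c) fun z hz hadj => by
      have := hYA z hz
      have := hc z
      rw [h.adj] at hadj
      grind
  by_cases hsame : v₁ = w₄ ∧ v₄ = w₁
  · obtain ⟨rfl, rfl⟩ := hsame
    obtain ⟨c, -, -, hc⟩ := exists_neighbors_eq hcubic a21.symm b34.symm m2.symm
    have hv : v₁ ∉ Y := hY.notMem_of_forall_eq (c := c) fun z hz hadj => by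
      have := hYA z hz
      have := hc z
      rw [h.adj] at hadj
      grind
    refine hfin {z | z ∈ A ∧ z ≠ v₂ ∧ z ≠ v₃ ∧ z ≠ v₁} Y Z hYG
      (fun z hz => ?_) hZG (fun z hz => ?_)
      (ncard_cutEdges_le_of_exchange_one he (f := s(v₁, c)) ?_)
    · have := hYA z hz
      simp only [Set.mem_ofPred_eq]
      grind
    · have := hZA z hz
      simp only [Set.mem_ofPred_eq]
      grind
    · intro x hx y hy hxy
      simp only [Set.mem_ofPred_eq, mk_mem_cutEdges, h.adj, Sym2.eq_iff] at hx hy ⊢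
      have f2 := h.nbr2 x
      have f2' := h.nbr2 y
      have f3 := h.nbr3 x
      have f3' := h.nbr3 y
      have hyx := hxy.symm
      have g1 := hc x
      have g1' := hc y
      grind (splits := 30)
  have e_ne : s(v₁, v₄) ≠ s(w₁, w₄) := by
    simp only [ne_eq, Sym2.eq_iff]
    tauto
  by_cases hv : G.Adj v₁ v₄ <;> by_cases hw : G.Adj w₁ w₄
  · obtain ⟨c, -, -, hc⟩ := exists_neighbors_eq hcubic a21.symm hv n3.symm
    obtain ⟨d, -, -, hd⟩ := exists_neighbors_eq hcubic b34.symm hw.symm n2.symm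
    have hv := hleaf c hc
    have hw := hleaf' d hd
    refine hfin {z | z ∈ A ∧ z ≠ v₂ ∧ z ≠ v₃ ∧ z ≠ v₁ ∧ z ≠ w₄} Y Z hYG
      (fun z hz => ?_) hZG (fun z hz => ?_)
      (ncard_cutEdges_le_of_exchange_two he hf e_ne (f₁ := s(v₁, c)) (f₂ := s(w₄, d)) ?_)
    · have := hYA z hz
      simp only [Set.mem_ofPred_eq]
      grind
    · have := hZA z hz
      simp only [Set.mem_ofPred_eq]
      grind
    · intro x hx y hy hxy
      simp only [Set.mem_ofPred_eq, mk_mem_cutEdges, h.adj, Sym2.eq_iff] at hx hy ⊢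
      have f2 := h.nbr2 x
      have f2' := h.nbr2 y
      have f3 := h.nbr3 x
      have f3' := h.nbr3 y
      have hyx := hxy.symm
      have g1 := hc x
      have g1' := hc y
      have g2 := hd x
      have g2' := hd y
      grind (splits := 30)
  · obtain ⟨c, -, -, hc⟩ := exists_neighbors_eq hcubic a21.symm hv n3.symm
    have hv := hleaf c hc
    refine hfin {z | z ∈ A ∧ z ≠ v₂ ∧ z ≠ v₃ ∧ z ≠ v₁} Y Z hYG
      (fun z hz => ?_) hZG (fun z hz => ?_)
      (ncard_cutEdges_le_of_exchange_two he hf e_ne (f₁ := s(v₁, c)) (f₂ := s(v₃, w₄)) ?_)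
    · have := hYA z hz
      simp only [Set.mem_ofPred_eq]
      grind
    · have := hZA z hz
      simp only [Set.mem_ofPred_eq]
      grind
    · intro x hx y hy hxy
      simp only [Set.mem_ofPred_eq, mk_mem_cutEdges, h.adj, Sym2.eq_iff] at hx hy ⊢
      have f2 := h.nbr2 x
      have f2' := h.nbr2 y
      have f3 := h.nbr3 x
      have f3' := h.nbr3 y
      have hyx := hxy.symm
      have g1 := hc x
      have g1' := hc y
      have g := hw
      have g' := fun hh : G.Adj w₄ w₁ => hw hh.symm
      grind (splits := 30)
  · obtain ⟨d, -, -, hd⟩ := exists_neighbors_eq hcubic b34.symm hw.symm n2.symm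
    have hw := hleaf' d hd
    refine hfin {z | z ∈ A ∧ z ≠ v₂ ∧ z ≠ v₃ ∧ z ≠ w₄} Y Z hYG
      (fun z hz => ?_) hZG (fun z hz => ?_)
      (ncard_cutEdges_le_of_exchange_two he hf e_ne (f₁ := s(w₄, d)) (f₂ := s(v₁, v₂)) ?_)
    · have := hYA z hz
      simp only [Set.mem_ofPred_eq]
      grind
    · have := hZA z hz
      simp only [Set.mem_ofPred_eq]
      grind
    · intro x hx y hy hxy
      simp only [Set.mem_ofPred_eq, mk_mem_cutEdges, h.adj, Sym2.eq_iff] at hx hy ⊢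
      have f2 := h.nbr2 x
      have f2' := h.nbr2 y
      have f3 := h.nbr3 x
      have f3' := h.nbr3 y
      have hyx := hxy.symm
      have g1 := hd x
      have g1' := hd y
      have g := hv
      have g' := fun hh : G.Adj v₄ v₁ => hv hh.symm
      grind (splits := 30)
  · refine hfin {z | z ∈ A ∨ z = v₂ ∨ z = v₃} Y Z hYG
      (fun z hz => ?_) hZG (fun z hz => ?_)
      (ncard_cutEdges_le_of_exchange_two he hf e_ne (f₁ := s(v₂, w₁)) (f₂ := s(v₃, v₄)) ?_)
    · have := hYA z hz
      simp only [Set.mem_ofPred_eq]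
      grind
    · have := hZA z hz
      simp only [Set.mem_ofPred_eq]
      grind
    · intro x hx y hy hxy
      simp only [Set.mem_ofPred_eq, mk_mem_cutEdges, h.adj, Sym2.eq_iff] at hx hy ⊢
      have f2 := h.nbr2 x
      have f2' := h.nbr2 y
      have f3 := h.nbr3 x
      have f3' := h.nbr3 y
      have hyx := hxy.symm
      have g1 := hv
      have g1' := fun hh : G.Adj v₄ v₁ => hv hh.symm
      have g2 := hw
      have g2' := fun hh : G.Adj w₄ w₁ => hw hh.symm
      grind (splits := 30)

/-- One new edge cannot cross the cut while the other lies within the side `A`. -/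
theorem false_of_same [Fintype V] (h : IsSplitting G G' v₁ v₂ v₃ v₄ w₁ w₄)
    (hcubic : CubicGraph G) {ℓ : ℕ} (hG : CyclicallyEdgeConnected G ℓ) {A Y Z : Set V}
    (hY : IsCore G' Y) (hYA : ∀ z ∈ Y, z ∈ A) (hZ : IsCore G' Z) (hZA : ∀ z ∈ Z, z ∉ A)
    (hlt : (cutEdges G' A).ncard < ℓ) (hv₁ : v₁ ∈ A) (hv₄ : v₄ ∉ A) (hw₁ : w₁ ∈ A)
    (hw₄ : w₄ ∈ A) : False := by
  obtain ⟨m1, m2, m3, m4, m5⟩ := h.ne_middle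
  obtain ⟨y2, y3⟩ := h.notMem_of_isCore hY
  obtain ⟨z2, z3⟩ := h.notMem_of_isCore hZ
  have n1 := h.ne13
  have n2 := h.new13
  have n3 := h.ne24
  have n4 := h.new24
  have n11 := h.ne11
  have n44 := h.ne44
  have a21 := (h.nbr2 v₁).2 (by simp)
  have b21 := (h.nbr2 w₁).2 (by simp)
  have a34 := (h.nbr3 v₄).2 (by simp)
  have b34 := (h.nbr3 w₄).2 (by simp)
  have he : s(v₁, v₄) ∈ cutEdges G' A :=
    mk_mem_cutEdges.2 ⟨(h.adj _ _).2 (by simp), by tauto⟩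
  have hfin : ∀ B Y Z : Set V, IsCore G Y → (∀ z ∈ Y, z ∈ B) → IsCore G Z → (∀ z ∈ Z, z ∉ B) →
      (cutEdges G B).ncard ≤ (cutEdges G' A).ncard → False := fun B Y Z hY hYB hZ hZB hle =>
    absurd (hG.le_of_isCore hY hYB hZ hZB) (by omega)
  obtain ⟨X, hXY, hXG⟩ := h.exists_isCore hY
  have hXA : ∀ z ∈ X, z ∈ A ∨ z = v₂ ∨ z = v₃ := fun z hz => (hXY hz).imp (hYA z) id
  have hZG : IsCore G Z := h.isCore_of_no_new_edge hZ (Or.inl fun hz => hZA _ hz hv₁)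
    (Or.inl fun hz => hZA _ hz hw₁)
  by_cases hv : G.Adj v₁ v₄
  · obtain ⟨c, -, -, hc⟩ := exists_neighbors_eq hcubic a34.symm hv.symm n1.symm
    have hvZ : v₄ ∉ Z := hZ.notMem_of_forall_eq (c := c) fun z hz hadj => by
      have := hZA z hz
      have := hc z
      rw [h.adj] at hadj
      grind
    refine hfin {z | z ∈ A ∨ z = v₂ ∨ z = v₃ ∨ z = v₄} X Z hXG
      (fun z hz => ?_) hZG (fun z hz => ?_)
      (ncard_cutEdges_le_of_exchange_one he (f := s(v₄, c)) ?_)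
    · have := hXA z hz
      simp only [Set.mem_ofPred_eq]
      tauto
    · have := hZA z hz
      simp only [Set.mem_ofPred_eq]
      grind
    · intro x hx y hy hxy
      simp only [Set.mem_ofPred_eq, mk_mem_cutEdges, h.adj, Sym2.eq_iff] at hx hy ⊢
      have f2 := h.nbr2 x
      have f2' := h.nbr2 y
      have f3 := h.nbr3 x
      have f3' := h.nbr3 y
      have hyx := hxy.symm
      have g1 := hc x
      have g1' := hc y
      grind (splits := 30)
  · refine hfin {z | z ∈ A ∨ z = v₂ ∨ z = v₃} X Z hXG
      (fun z hz => ?_) hZG (fun z hz => ?_)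
      (ncard_cutEdges_le_of_exchange_one he (f := s(v₃, v₄)) ?_)
    · have := hXA z hz
      simp only [Set.mem_ofPred_eq]
      tauto
    · have := hZA z hz
      simp only [Set.mem_ofPred_eq]
      grind
    · intro x hx y hy hxy
      simp only [Set.mem_ofPred_eq, mk_mem_cutEdges, h.adj, Sym2.eq_iff] at hx hy ⊢
      have f2 := h.nbr2 x
      have f2' := h.nbr2 y
      have f3 := h.nbr3 x
      have f3' := h.nbr3 y
      have hyx := hxy.symm
      have g1 := hv
      have g1' := fun hh : G.Adj v₄ v₁ => hv hh.symm
      grind (splits := 30)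

theorem notMem_cutEdges [Fintype V] (h : IsSplitting G G' v₁ v₂ v₃ v₄ w₁ w₄)
    (hcubic : CubicGraph G) {ℓ : ℕ} (hG : CyclicallyEdgeConnected G ℓ) {A Y Z : Set V}
    (hY : IsCore G' Y) (hYA : ∀ z ∈ Y, z ∈ A) (hZ : IsCore G' Z) (hZA : ∀ z ∈ Z, z ∉ A)
    (hlt : (cutEdges G' A).ncard < ℓ) : s(v₁, v₄) ∉ cutEdges G' A := by
  have key : ∀ A Y Z : Set V, IsCore G' Y → (∀ z ∈ Y, z ∈ A) → IsCore G' Z →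
      (∀ z ∈ Z, z ∉ A) → (cutEdges G' A).ncard < ℓ → v₁ ∈ A → v₄ ∉ A → False := by
    intro A Y Z hY hYA hZ hZA hlt hv₁ hv₄
    by_cases hw₁ : w₁ ∈ A <;> by_cases hw₄ : w₄ ∈ A
    · exact h.false_of_same hcubic hG hY hYA hZ hZA hlt hv₁ hv₄ hw₁ hw₄
    · exact h.false_of_parallel hcubic hG hY hYA hZ hZA hlt hv₁ hv₄ hw₁ hw₄
    · exact h.false_of_cross hcubic hG hY hYA hZ hZA hlt hv₁ hv₄ hw₁ hw₄
    · exact h.reverse.false_of_same (A := Aᶜ) hcubic hG hZ hZA hY (fun z hz => not_not.2 (hYA z hz))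
        (by rwa [cutEdges_compl]) hv₄ (not_not.2 hv₁) hw₄ hw₁
  intro hmem
  have hmem' := (mk_mem_cutEdges.1 hmem).2
  by_cases hv₁ : v₁ ∈ A
  · exact key A Y Z hY hYA hZ hZA hlt hv₁ (hmem'.1 hv₁)
  · exact key Aᶜ Z Y hZ hZA hY (fun z hz => not_not.2 (hYA z hz)) (by rwa [cutEdges_compl]) hv₁
      (not_not.2 (by tauto))

end IsSplitting

/-- Adding at most two edges `f₁` and `f₂` to `C` increases its size by at most two. -/
theorem ncard_cutEdges_le_add_two [Fintype V] {G : SimpleGraph V} {B : Set V}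
    {C : Set (Sym2 V)} {f₁ f₂ : Sym2 V}
    (h : ∀ x ∈ B, ∀ y ∉ B, G.Adj x y → s(x, y) ∈ C ∨ s(x, y) = f₁ ∨ s(x, y) = f₂) :
    (cutEdges G B).ncard ≤ C.ncard + 2 := by
  have hsub : cutEdges G B ⊆ insert f₁ (insert f₂ C) := by
    rintro _ ⟨hadj, x, y, rfl, hx, hy⟩
    have := h x hx y hy hadj
    simp only [Set.mem_insert_iff]
    tauto
  have h1 := Set.ncard_le_ncard hsub
  have h2 := Set.ncard_insert_le f₁ (insert f₂ C)
  have h3 := Set.ncard_insert_le f₂ C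
  omega

namespace IsSplitting

variable {G G' : SimpleGraph V} {v₁ v₂ v₃ v₄ w₁ w₄ : V}

/-- If both new edges lie within the side `A`, then the cut is not smaller than `ℓ`. -/
theorem le_of_uncut_same [Fintype V] (h : IsSplitting G G' v₁ v₂ v₃ v₄ w₁ w₄)
    {ℓ : ℕ} (hG : CyclicallyEdgeConnected G ℓ) {A Y Z : Set V}
    (hY : IsCore G' Y) (hYA : ∀ z ∈ Y, z ∈ A) (hZ : IsCore G' Z) (hZA : ∀ z ∈ Z, z ∉ A)
    (hv₁ : v₁ ∈ A) (hv₄ : v₄ ∈ A) (hw₁ : w₁ ∈ A) (hw₄ : w₄ ∈ A) :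
    ℓ ≤ (cutEdges G' A).ncard := by
  obtain ⟨z2, z3⟩ := h.notMem_of_isCore hZ
  obtain ⟨X, hXY, hXG⟩ := h.exists_isCore hY
  have hXA : ∀ z ∈ X, z ∈ A ∨ z = v₂ ∨ z = v₃ := fun z hz => (hXY hz).imp (hYA z) id
  have hZG : IsCore G Z := h.isCore_of_no_new_edge hZ (Or.inl fun hz => hZA _ hz hv₁)
    (Or.inl fun hz => hZA _ hz hw₁)
  refine (hG.le_of_isCore (B := {z | z ∈ A ∨ z = v₂ ∨ z = v₃}) hXG hXA hZG
    (fun z hz => ?_)).trans (Set.ncard_le_ncard ?_)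
  · have := hZA z hz
    simp only [Set.mem_ofPred_eq]
    grind
  · rintro _ ⟨hxy, x, y, rfl, hx, hy⟩
    simp only [Set.mem_ofPred_eq, mk_mem_cutEdges, h.adj, SimpleGraph.mem_edgeSet] at hxy hx hy ⊢
    have f2 := h.nbr2 x
    have f2' := h.nbr2 y
    have f3 := h.nbr3 x
    have f3' := h.nbr3 y
    have hyx := hxy.symm
    grind (splits := 30)

/-- If the cut separates the two new edges from each other, then it has at least `ℓ - 2` edges. -/
theorem le_add_two_of_separated [Fintype V] (h : IsSplitting G G' v₁ v₂ v₃ v₄ w₁ w₄)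
    (hcubic : CubicGraph G) {ℓ : ℕ} (hG : CyclicallyEdgeConnected G ℓ)
    (hcard : 2 * ℓ + 2 ≤ Fintype.card V) {A Y Z : Set V}
    (hY : IsCore G' Y) (hYA : ∀ z ∈ Y, z ∈ A) (hZ : IsCore G' Z) (hZA : ∀ z ∈ Z, z ∉ A)
    (hv₁ : v₁ ∈ A) (hv₄ : v₄ ∈ A) (hw₁ : w₁ ∉ A) (hw₄ : w₄ ∉ A) :
    ℓ ≤ (cutEdges G' A).ncard + 2 := by
  obtain ⟨m1, m2, m3, m4, m5⟩ := h.ne_middle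
  have n1 := h.ne13
  have n2 := h.new13
  have n3 := h.ne24
  have n4 := h.new24
  set B : Set V := {z | z ∈ A ∧ z ≠ v₂ ∧ z ≠ v₃} with hB
  set D : Set V := {z | z ∉ A ∧ z ≠ v₂ ∧ z ≠ v₃} with hD
  have hBcut : (cutEdges G B).ncard ≤ (cutEdges G' A).ncard + 2 := by
    refine ncard_cutEdges_le_add_two (f₁ := s(v₁, v₂)) (f₂ := s(v₄, v₃)) fun x hx y hy hxy => ?_
    simp only [hB, Set.mem_ofPred_eq, mk_mem_cutEdges, h.adj, Sym2.eq_iff] at hx hy ⊢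
    have f2 := h.nbr2 x
    have f3 := h.nbr3 x
    have hyx := hxy.symm
    grind (splits := 30)
  have hDcut : (cutEdges G D).ncard ≤ (cutEdges G' A).ncard + 2 := by
    refine ncard_cutEdges_le_add_two (f₁ := s(w₁, v₂)) (f₂ := s(w₄, v₃)) fun x hx y hy hxy => ?_
    simp only [hD, Set.mem_ofPred_eq, mk_mem_cutEdges, h.adj, Sym2.eq_iff] at hx hy ⊢
    have f2 := h.nbr2 x
    have f3 := h.nbr3 x
    have hyx := hxy.symm
    grind (splits := 30)
  have core_enlarge : ∀ {T S : Set V}, IsCore G' T → (∀ z ∈ T, z ∉ S) →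
      v₂ ∉ S → v₃ ∉ S → ∃ X, IsCore G X ∧ ∀ z ∈ X, z ∉ S := by
    intro T S hT hTS h2 h3
    obtain ⟨X, hXT, hX⟩ := h.exists_isCore hT
    refine ⟨X, hX, fun z hz => ?_⟩
    rcases hXT hz with hz | rfl | rfl
    exacts [hTS z hz, h2, h3]
  by_cases hcB : ∃ T ⊆ B, IsCore G T
  · obtain ⟨T, hTB, hT⟩ := hcB
    obtain ⟨X, hX, hXB⟩ := core_enlarge (S := B) hZ (fun z hz hzB => hZA z hz hzB.1)
      (fun hz => hz.2.1 rfl) (fun hz => hz.2.2 rfl)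
    exact (hG.le_of_isCore hT hTB hX hXB).trans hBcut
  by_cases hcD : ∃ T ⊆ D, IsCore G T
  · obtain ⟨T, hTD, hT⟩ := hcD
    obtain ⟨X, hX, hXD⟩ := core_enlarge (S := D) hY (fun z hz hzD => hzD.1 (hYA z hz))
      (fun hz => hz.2.1 rfl) (fun hz => hz.2.2 rfl)
    exact (hG.le_of_isCore hT hTD hX hXD).trans hDcut
  have b1 := ncard_add_two_le_of_no_isCore hcubic B ⟨v₁, hv₁, m1, n1⟩
    fun T hT hc => hcB ⟨T, hT, hc⟩
  have b2 := ncard_add_two_le_of_no_isCore hcubic D ⟨w₁, hw₁, m3, n2⟩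
    fun T hT hc => hcD ⟨T, hT, hc⟩
  have hcover : (Set.univ : Set V) ⊆ (B ∪ D) ∪ {v₂, v₃} := by
    intro z _
    simp only [hB, hD, Set.mem_union, Set.mem_ofPred_eq, Set.mem_insert_iff,
      Set.mem_singleton_iff]
    tauto
  have c1 := Set.ncard_le_ncard hcover
  rw [Set.ncard_univ, Nat.card_eq_fintype_card] at c1
  have c2 := Set.ncard_union_le (B ∪ D) {v₂, v₃}
  have c3 := Set.ncard_union_le B D
  have c4 : ({v₂, v₃} : Set V).ncard ≤ 2 := (Set.ncard_pair m2.symm).le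
  omega

end IsSplitting

/-- Splitting off a path `v₁v₂v₃v₄` in a cyclically `ℓ`-edge-connected cubic graph with
at least `2ℓ+2` vertices: every cyclic `ℓ'`-edge-cut of the resulting graph `G'` with
`ℓ' < ℓ` satisfies `ℓ' ≥ ℓ - 2` and contains neither `v₁v₄` nor `v₁'v₄'`.
(Here `G'` is modelled on the same vertex set, with `v₂` and `v₃` isolated.) -/
theorem splitoff_cyclic_cut
    [Fintype V] (G G' : SimpleGraph V) (ℓ : ℕ)
    (hcubic : CubicGraph G)
    (hG : CyclicallyEdgeConnected G ℓ) (hcard : 2 * ℓ + 2 ≤ Fintype.card V)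
    (v₁ v₂ v₃ v₄ v₁' v₄' : V)
    (h12 : v₁ ≠ v₂) (h13 : v₁ ≠ v₃) (h14 : v₁ ≠ v₄)
    (h23 : v₂ ≠ v₃) (h24 : v₂ ≠ v₄) (h34 : v₃ ≠ v₄)
    (ha12 : G.Adj v₁ v₂) (ha23 : G.Adj v₂ v₃) (ha34 : G.Adj v₃ v₄)
    (ha2 : G.Adj v₂ v₁') (h1'1 : v₁' ≠ v₁) (h1'3 : v₁' ≠ v₃)
    (ha3 : G.Adj v₃ v₄') (h4'2 : v₄' ≠ v₂) (h4'4 : v₄' ≠ v₄)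
    (hG' : ∀ x y, G'.Adj x y ↔
      ((G.Adj x y ∧ x ∉ ({v₂, v₃} : Set V) ∧ y ∉ ({v₂, v₃} : Set V)) ∨
        s(x, y) = s(v₁, v₄) ∨ s(x, y) = s(v₁', v₄')))
    (A' : Set V) (ℓ' : ℕ) (hcut : (cutEdges G' A').ncard = ℓ')
    (hcyc : CyclicCut G' A') (hlt : ℓ' < ℓ) :
    ℓ - 2 ≤ ℓ' ∧ s(v₁, v₄) ∉ cutEdges G' A' ∧ s(v₁', v₄') ∉ cutEdges G' A' := by
  have nbr2 : ∀ z, G.Adj v₂ z ↔ z = v₁ ∨ z = v₃ ∨ z = v₁' := by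
    obtain ⟨c, -, -, hc⟩ := exists_neighbors_eq hcubic ha12.symm ha23 h13
    have := hc v₁'
    grind
  have nbr3 : ∀ z, G.Adj v₃ z ↔ z = v₄ ∨ z = v₂ ∨ z = v₄' := by
    obtain ⟨c, -, -, hc⟩ := exists_neighbors_eq hcubic ha34 ha23.symm h24.symm
    have := hc v₄'
    grind
  have hne : v₁' ≠ v₄' := by
    rintro rfl
    exact G'.loopless.irrefl v₁' ((hG' _ _).2 (by simp))
  have h : IsSplitting G G' v₁ v₂ v₃ v₄ v₁' v₄' :=
    ⟨h14, h1'1.symm, h4'4.symm, hne, h13, h1'3, h24.symm, h4'2, nbr2, nbr3, fun x y => by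
      rw [hG']
      simp only [Set.mem_insert_iff, Set.mem_singleton_iff, Sym2.eq_iff, not_or, and_assoc]⟩
  obtain ⟨Y, hYA, hY⟩ := exists_isCore_of_not_isAcyclic hcyc.1
  obtain ⟨Z, hZA, hZ⟩ := exists_isCore_of_not_isAcyclic hcyc.2
  subst hcut
  have he := h.notMem_cutEdges hcubic hG hY hYA hZ hZA hlt
  have hf := h.swap.notMem_cutEdges hcubic hG hY hYA hZ hZA hlt
  refine ⟨?_, he, hf⟩
  have hYA' : ∀ z ∈ Y, z ∉ A'ᶜ := fun z hz => not_not.2 (hYA hz)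
  have hv₁₄ : v₄ ∈ A' ↔ v₁ ∈ A' := by
    by_contra hc
    exact he (mk_mem_cutEdges.2 ⟨(h.adj _ _).2 (by simp), by clear * - hc; tauto⟩)
  have hw₁₄ : v₄' ∈ A' ↔ v₁' ∈ A' := by
    by_contra hc
    exact hf (mk_mem_cutEdges.2 ⟨(h.adj _ _).2 (by simp), by clear * - hc; tauto⟩)
  by_cases hv : v₁ ∈ A' <;> by_cases hw : v₁' ∈ A'
  · have := h.le_of_uncut_same hG hY hYA hZ hZA hv (hv₁₄.2 hv) hw (hw₁₄.2 hw)
    omega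
  · have := h.le_add_two_of_separated hcubic hG hcard hY hYA hZ hZA hv (hv₁₄.2 hv) hw
      (mt hw₁₄.1 hw)
    omega
  · have := h.swap.le_add_two_of_separated hcubic hG hcard hY hYA hZ hZA hw (hw₁₄.2 hw) hv
      (mt hv₁₄.1 hv)
    omega
  · have := h.le_of_uncut_same hG hZ hZA hY hYA' hv (mt hv₁₄.1 hv) hw (mt hw₁₄.1 hw)
    rw [cutEdges_compl] at this
    omega
end

section
/- Every cubic bridgeless graph is matching-covered: for every edge e there is a perfect matching containing e. Moreover, for any two edges e and f of a cubic bridgeless graph there exists a perfect matching avoiding both e and f. -/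
open SimpleGraph
open scoped Classical

universe u

variable {V : Type u}

/-- A family of pairwise disjoint odd vertex sets, each disjoint from `S` and with all
neighbours outside itself lying in `S`. -/
def IsOddBarrier (G : SimpleGraph V) (S : Finset V) (𝒞 : Finset (Finset V)) : Prop :=
  (𝒞 : Set (Finset V)).PairwiseDisjoint id ∧
    ∀ C ∈ 𝒞, Odd C.card ∧ ∀ c ∈ C, c ∉ S ∧ ∀ y, G.Adj c y → y ∈ C ∨ y ∈ S

/-- The ordered pairs of adjacent vertices whose first vertex lies in `A`. -/
noncomputable def adjPairs (G : SimpleGraph V) [G.LocallyFinite] (A : Finset V) :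
    Finset (V × V) :=
  A.biUnion fun v => (G.neighborFinset v).image (Prod.mk v)

/-- The ordered pairs of adjacent vertices leaving `A`. -/
noncomputable def leavingPairs (G : SimpleGraph V) [G.LocallyFinite] (A : Finset V) :
    Finset (V × V) :=
  (adjPairs G A).filter fun p => p.2 ∉ A

section Counting

variable {G : SimpleGraph V} [G.LocallyFinite] {A : Finset V}

lemma mem_adjPairs {p : V × V} : p ∈ adjPairs G A ↔ p.1 ∈ A ∧ G.Adj p.1 p.2 := by
  obtain ⟨x, y⟩ := p
  simp [adjPairs]

lemma mem_leavingPairs {p : V × V} :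
    p ∈ leavingPairs G A ↔ p.1 ∈ A ∧ G.Adj p.1 p.2 ∧ p.2 ∉ A := by
  simp [leavingPairs, mem_adjPairs, and_assoc]

lemma card_adjPairs {d : ℕ} (hd : G.IsRegularOfDegree d) : (adjPairs G A).card = d * A.card := by
  rw [adjPairs, Finset.card_biUnion]
  · simp [Finset.card_image_of_injective _ (Prod.mk_right_injective _), hd.degree_eq, mul_comm]
  · intro x _ y _ hxy
    simp only [Function.onFun, Finset.disjoint_left]
    grind

lemma even_card_filter_adjPairs : Even ((adjPairs G A).filter fun p => p.2 ∈ A).card := by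
  rw [← ZMod.natCast_eq_zero_iff_even, Finset.cast_card]
  refine Finset.sum_involution (fun p _ => p.swap) (fun _ _ => by decide) ?_ ?_ (by simp)
  · rintro ⟨x, y⟩ h _ heq
    simp only [Finset.mem_filter, mem_adjPairs] at h
    simp only [Prod.swap_prod_mk, Prod.mk.injEq] at heq
    exact h.1.2.ne heq.2
  · rintro ⟨x, y⟩ h
    simp only [Finset.mem_filter, mem_adjPairs] at h
    simp [mem_adjPairs, h.2, h.1.1, h.1.2.symm]

lemma odd_card_leavingPairs (hd : G.IsRegularOfDegree 3) (hA : Odd A.card) :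
    Odd (leavingPairs G A).card := by
  have h := Finset.card_filter_add_card_filter_not (s := adjPairs G A) (fun p => p.2 ∈ A)
  rw [card_adjPairs hd] at h
  have he := even_card_filter_adjPairs (G := G) (A := A)
  have : Odd (3 * A.card) := Odd.mul (by decide) hA
  rw [← h] at this
  exact (Nat.odd_add'.1 this).2 he

lemma card_leavingPairs_ne_one (hbl : Bridgeless G) : (leavingPairs G A).card ≠ 1 := by
  intro h
  obtain ⟨⟨x, y⟩, hxy⟩ := Finset.card_eq_one.1 h
  have hmem : (x, y) ∈ leavingPairs G A := by simp [hxy]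
  obtain ⟨hx, hadj, hy⟩ := mem_leavingPairs.1 hmem
  refine hbl s(x, y) hadj (isBridge_iff.2 ?_)
  rintro ⟨w⟩
  obtain ⟨d, -, hd₁, hd₂⟩ := w.exists_boundary_dart (A : Set V) hx hy
  have hd := d.adj
  rw [deleteEdges_adj] at hd
  have : (d.fst, d.snd) ∈ leavingPairs G A := mem_leavingPairs.2 ⟨hd₁, hd.1, hd₂⟩
  rw [hxy, Finset.mem_singleton, Prod.mk.injEq] at this
  exact hd.2 (by simp [this.1, this.2])

lemma three_le_card_leavingPairs (hd : G.IsRegularOfDegree 3) (hbl : Bridgeless G)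
    (hA : Odd A.card) : 3 ≤ (leavingPairs G A).card := by
  have h₁ := odd_card_leavingPairs hd hA
  have h₂ := card_leavingPairs_ne_one (A := A) hbl
  obtain ⟨k, hk⟩ := h₁
  omega

/-- Deleting two edges from a bridgeless cubic graph preserves Tutte's condition. -/
lemma IsOddBarrier.card_le (hd : G.IsRegularOfDegree 3) (hbl : Bridgeless G) {e f : Sym2 V}
    {S : Finset V} {𝒞 : Finset (Finset V)} (h : IsOddBarrier (G.deleteEdges {e, f}) S 𝒞) :
    𝒞.card ≤ S.card := by
  obtain ⟨hdisj, hC⟩ := h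
  induction e with | _ a b
  induction f with | _ c d
  let E : Finset (V × V) := {(a, b), (b, a), (c, d), (d, c)}
  have hE : E.card ≤ 4 := Finset.card_le_four
  have hmemE {x y : V} (hadj : G.Adj x y)
      (hnot : ¬(G.deleteEdges {s(a, b), s(c, d)}).Adj x y) : (x, y) ∈ E ∧ (y, x) ∈ E := by
    simp only [deleteEdges_adj, hadj, true_and, not_not, Set.mem_insert_iff,
      Set.mem_singleton_iff, Sym2.eq_iff] at hnot
    simp only [E, Finset.mem_insert, Finset.mem_singleton, Prod.mk.injEq]
    tauto
  let X := S ∪ 𝒞.biUnion id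
  let U := 𝒞.biUnion fun C => (leavingPairs G C).image Prod.swap
  have hU : 𝒞.card * 3 ≤ U.card := by
    rw [Finset.card_biUnion]
    · rw [← smul_eq_mul]
      refine Finset.card_nsmul_le_sum _ _ _ fun C hCmem => ?_
      rw [Finset.card_image_of_injective _ Prod.swap_injective]
      exact three_le_card_leavingPairs hd hbl (hC C hCmem).1
    · intro C₁ h₁ C₂ h₂ hne
      have hdis : Disjoint C₁ C₂ := hdisj h₁ h₂ hne
      rw [Finset.disjoint_left] at hdis
      simp only [Function.onFun, Finset.disjoint_left]
      rintro ⟨q, p⟩ hp₁ hp₂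
      simp only [Finset.mem_image, Prod.exists, mem_leavingPairs, Prod.swap_prod_mk,
        Prod.mk.injEq] at hp₁ hp₂
      grind
  have hUX : Disjoint U (leavingPairs G X) := by
    rw [Finset.disjoint_left]
    rintro ⟨q, p⟩ hp₁ hp₂
    simp only [U, X, Finset.mem_biUnion, Finset.mem_image, Prod.exists, mem_leavingPairs,
      Prod.swap_prod_mk, Prod.mk.injEq, Finset.mem_union, id] at hp₁ hp₂
    grind
  have hsub : U ∪ leavingPairs G X ⊆ adjPairs G S ∪ E := by
    rintro ⟨q, p⟩ hqp
    rw [Finset.mem_union, mem_adjPairs]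
    rcases Finset.mem_union.1 hqp with hqp | hqp
    · simp only [U, Finset.mem_biUnion, Finset.mem_image, Prod.exists, mem_leavingPairs,
        Prod.swap_prod_mk, Prod.mk.injEq] at hqp
      obtain ⟨C, hCmem, p, q, ⟨hp, hadj, hq⟩, rfl, rfl⟩ := hqp
      by_cases hG : (G.deleteEdges {s(a, b), s(c, d)}).Adj p q
      · exact .inl ⟨(((hC C hCmem).2 p hp).2 q hG).resolve_left hq, hadj.symm⟩
      · exact .inr (hmemE hadj hG).2
    · obtain ⟨hq, hadj, hp⟩ := mem_leavingPairs.1 hqp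
      simp only [X, Finset.mem_union, Finset.mem_biUnion, id, not_or, not_exists, not_and] at hq hp
      rcases hq with hq | ⟨C, hCmem, hq⟩
      · exact .inl ⟨hq, hadj⟩
      · refine .inr (hmemE hadj fun hG => ?_).1
        rcases ((hC C hCmem).2 q hq).2 p hG with h | h
        · exact hp.2 C hCmem h
        · exact hp.1 h
  have hcard := (Finset.card_le_card hsub).trans (Finset.card_union_le _ _)
  rw [Finset.card_union_of_disjoint hUX, card_adjPairs hd] at hcard
  by_contra! hlt
  have hk : 𝒞.card = S.card + 1 := by omega
  have hX : Odd X.card := by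
    have hSd : Disjoint S (𝒞.biUnion id) := by
      rw [Finset.disjoint_left]
      intro x hx hx'
      obtain ⟨C, hCmem, hxC⟩ := Finset.mem_biUnion.1 hx'
      exact ((hC C hCmem).2 x hxC).1 hx
    have hodd : Odd (∑ C ∈ 𝒞, C.card) ↔ Odd 𝒞.card := by
      rw [Finset.odd_sum_iff_odd_card_odd, Finset.filter_true_of_mem fun C hCmem => (hC C hCmem).1]
    rw [Finset.card_union_of_disjoint hSd, Finset.card_biUnion hdisj, Nat.odd_add]
    simp only [id, ← Nat.not_odd_iff_even, hodd, hk, Nat.odd_add_one, not_not]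
  have := three_le_card_leavingPairs hd hbl hX
  omega

end Counting

/-- A version of Tutte's theorem in which the vertices outside `B` form a clique, so that only
barriers inside `B` matter. -/
lemma exists_isPerfectMatching_of_isClique_compl {α : Type*} [Finite α] {H : SimpleGraph α}
    (heven : Even (Nat.card α)) {B : Set α} (hB : H.IsClique Bᶜ)
    (h : ∀ S 𝒞, IsOddBarrier H S 𝒞 → (∀ C ∈ 𝒞, (C : Set α) ⊆ B) → 𝒞.card ≤ S.card) :
    ∃ M : H.Subgraph, M.IsPerfectMatching := by
  cases nonempty_fintype α
  rw [tutte]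
  intro u hu
  rw [IsTutteViolator] at hu
  set K := ((⊤ : H.Subgraph).deleteVerts u).coe with hK
  have hadjK {x y : ((⊤ : H.Subgraph).deleteVerts u).verts} (hxy : H.Adj x y) : K.Adj x y := by
    have hx := x.2.2
    have hy := y.2.2
    simp [K, hxy, hx, hy]
  let O := K.oddComponents
  let I : Set K.ConnectedComponent := {c ∈ O | ∀ v ∈ c.supp, (v : α) ∈ B}
  have hsub : (O \ I).Subsingleton := by
    rintro c₁ ⟨h₁, h₁'⟩ c₂ ⟨h₂, h₂'⟩
    simp only [I, Set.mem_ofPred_eq, not_and, not_forall] at h₁' h₂'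
    obtain ⟨v, hv, hvB⟩ := h₁' h₁
    obtain ⟨w, hw, hwB⟩ := h₂' h₂
    rw [ConnectedComponent.mem_supp_iff] at hv hw
    rw [← hv, ← hw]
    by_cases hvw : v = w
    · rw [hvw]
    · exact ConnectedComponent.sound (hadjK (hB hvB hwB (Subtype.coe_ne_coe.2 hvw))).reachable
  have hOI : O.ncard ≤ I.ncard + 1 := by
    have h₁ := Set.ncard_le_ncard_sdiff_add_ncard O I
    have h₂ := Set.ncard_le_one_iff_subsingleton.2 hsub
    omega
  have hpar : Odd O.ncard ↔ Odd u.ncard := by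
    have hcard : Nat.card ((⊤ : H.Subgraph).deleteVerts u).verts + u.ncard = Nat.card α := by
      rw [Nat.card_coe_set_eq, Subgraph.deleteVerts_verts, Subgraph.verts_top,
        ← Set.compl_eq_univ_sdiff, add_comm, Set.ncard_add_ncard_compl]
    rw [odd_ncard_oddComponents]
    rw [← hcard, Nat.even_add'] at heven
    exact heven
  have hlt : u.ncard < I.ncard := by
    have hne : O.ncard ≠ u.ncard + 1 := fun heq => by
      rw [heq, Nat.odd_add_one] at hpar
      tauto
    have : u.ncard < O.ncard := hu
    omega
  let toFin (c : K.ConnectedComponent) : Finset α := (Subtype.val '' c.supp).toFinset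
  have hmem {c : K.ConnectedComponent} {x : α} :
      x ∈ toFin c ↔ ∃ hx, K.connectedComponentMk ⟨x, hx⟩ = c := by
    simp [toFin]
  have hdis {c₁ c₂ : K.ConnectedComponent} (hne : c₁ ≠ c₂) : Disjoint (toFin c₁) (toFin c₂) := by
    rw [Finset.disjoint_left]
    intro x h₁ h₂
    obtain ⟨_, h₁⟩ := hmem.1 h₁
    obtain ⟨_, h₂⟩ := hmem.1 h₂
    exact hne (h₁.symm.trans h₂)
  have hinj : Function.Injective toFin := by
    intro c₁ c₂ heq
    by_contra hne
    obtain ⟨x, hx⟩ := c₁.nonempty_supp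
    have hx' : (x : α) ∈ toFin c₁ := hmem.2 ⟨x.2, hx⟩
    exact Finset.disjoint_left.1 (hdis hne) hx' (heq ▸ hx')
  have key := h u.toFinset (I.toFinset.image toFin) ⟨?_, ?_⟩ ?_
  · rw [Finset.card_image_of_injective _ hinj, ← Set.ncard_eq_toFinset_card',
      ← Set.ncard_eq_toFinset_card'] at key
    omega
  · intro C₁ h₁ C₂ h₂ hne
    simp only [Finset.coe_image, Set.coe_toFinset] at h₁ h₂
    obtain ⟨c₁, -, rfl⟩ := h₁
    obtain ⟨c₂, -, rfl⟩ := h₂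
    exact hdis fun heq => hne (congrArg toFin heq)
  · intro C hC
    obtain ⟨c, hc, rfl⟩ := Finset.mem_image.1 hC
    rw [Set.mem_toFinset] at hc
    refine ⟨?_, fun x hx => ?_⟩
    · have : Odd c.supp.ncard := hc.1
      rwa [← Set.ncard_eq_toFinset_card', Set.ncard_image_of_injective _ Subtype.val_injective]
    · obtain ⟨hx', rfl⟩ := hmem.1 hx
      refine ⟨by simpa using hx'.2, fun y hxy => ?_⟩
      by_cases hy : y ∈ u
      · exact .inr (by simpa using hy)
      · refine .inl (hmem.2 ⟨⟨trivial, hy⟩, ?_⟩)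
        exact ConnectedComponent.sound (hadjK hxy.symm).reachable
  · intro C hC x hx
    obtain ⟨c, hc, rfl⟩ := Finset.mem_image.1 hC
    rw [Set.mem_toFinset] at hc
    obtain ⟨hx', hxc⟩ := hmem.1 hx
    exact hc.2 _ hxc

section Compactness

variable {G : SimpleGraph V} [G.LocallyFinite]

/-- Under Tutte's condition, every finite set of vertices is covered by some matching. -/
lemma exists_partial_partner (h : ∀ S 𝒞, IsOddBarrier G S 𝒞 → 𝒞.card ≤ S.card) (F : Finset V) :
    ∃ g : V → V, ∀ v ∈ F, G.Adj v (g v) ∧ g (g v) = v := by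
  let W : Finset V := F ∪ F.biUnion fun v => G.neighborFinset v
  have hFW {v : V} (hv : v ∈ F) : v ∈ W := Finset.mem_union_left _ hv
  have hNW {v w : V} (hv : v ∈ F) (hw : G.Adj v w) : w ∈ W :=
    Finset.mem_union_right _ (Finset.mem_biUnion.2 ⟨v, hv, by simpa using hw⟩)
  let φ : W ⊕ W → V := Sum.elim (↑) (↑)
  let B : Set (W ⊕ W) := {x | ∃ v : W, x = Sum.inl v ∧ (v : V) ∈ F}
  let H : SimpleGraph (W ⊕ W) :=
    { Adj := fun x y => x ≠ y ∧
        ((x ∉ B ∧ y ∉ B) ∨ ∃ v w : W, x = Sum.inl v ∧ y = Sum.inl w ∧ G.Adj v w)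
      symm := ⟨by
        rintro x y ⟨hne, h | ⟨v, w, hv, hw, hvw⟩⟩
        · exact ⟨hne.symm, .inl h.symm⟩
        · exact ⟨hne.symm, .inr ⟨w, v, hw, hv, hvw.symm⟩⟩⟩
      loopless := ⟨fun x hx => hx.1 rfl⟩ }
  have hφB : Set.InjOn φ B := by
    rintro _ ⟨v, rfl, -⟩ _ ⟨w, rfl, -⟩ heq
    exact congrArg Sum.inl (Subtype.ext heq)
  have hHB {v : W} (hv : (v : V) ∈ F) {y : W ⊕ W} (hy : H.Adj (Sum.inl v) y) :
      ∃ w : W, y = Sum.inl w ∧ G.Adj v w := by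
    obtain ⟨-, h | ⟨v', w, hv', hw, hvw⟩⟩ := hy
    · exact absurd ⟨v, rfl, hv⟩ h.1
    · obtain rfl := Sum.inl_injective hv'
      exact ⟨w, hw, hvw⟩
  obtain ⟨M, hM⟩ : ∃ M : H.Subgraph, M.IsPerfectMatching := by
    refine exists_isPerfectMatching_of_isClique_compl (B := B) ?_ ?_ ?_
    · rw [Nat.card_sum]
      exact Even.add_self _
    · exact fun x hx y hy hne => ⟨hne, .inl ⟨hx, hy⟩⟩
    · intro S 𝒞 ⟨hdisj, hC⟩ hCB
      have hinj : Set.InjOn (Finset.image φ) (𝒞 : Set (Finset (W ⊕ W))) := by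
        intro C₁ h₁ C₂ h₂ heq
        rw [← Finset.coe_inj, Finset.coe_image, Finset.coe_image] at heq
        exact Finset.coe_inj.1 ((hφB.image_eq_image_iff (hCB _ h₁) (hCB _ h₂)).1 heq)
      have key := h ((S.filter fun x => x.isLeft).image φ) (𝒞.image (Finset.image φ)) ⟨?_, ?_⟩
      · rw [Finset.card_image_of_injOn hinj] at key
        exact key.trans (Finset.card_image_le.trans (Finset.card_filter_le _ _))
      · intro D₁ h₁ D₂ h₂ hne
        simp only [Finset.coe_image] at h₁ h₂
        obtain ⟨C₁, h₁, rfl⟩ := h₁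
        obtain ⟨C₂, h₂, rfl⟩ := h₂
        have hdis : Disjoint C₁ C₂ := hdisj h₁ h₂ fun heq => hne (by rw [heq])
        change Disjoint (C₁.image φ) (C₂.image φ)
        rw [Finset.disjoint_left] at hdis ⊢
        intro x hx₁ hx₂
        obtain ⟨y₁, hy₁, rfl⟩ := Finset.mem_image.1 hx₁
        obtain ⟨y₂, hy₂, heq⟩ := Finset.mem_image.1 hx₂
        exact hdis hy₁ (hφB (hCB _ h₂ hy₂) (hCB _ h₁ hy₁) heq ▸ hy₂)
      · intro D hD
        obtain ⟨C, hCmem, rfl⟩ := Finset.mem_image.1 hD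
        have hCB := hCB C hCmem
        obtain ⟨hodd, hC⟩ := hC C hCmem
        refine ⟨by rwa [Finset.card_image_of_injOn (hφB.mono hCB)], fun x hx => ?_⟩
        obtain ⟨y, hy, rfl⟩ := Finset.mem_image.1 hx
        obtain ⟨v, rfl, hvF⟩ := hCB hy
        obtain ⟨hvS, hclosed⟩ := hC _ hy
        refine ⟨fun hmem => ?_, fun w (hw : G.Adj v w) => ?_⟩
        · obtain ⟨z, hz, hzv⟩ := Finset.mem_image.1 hmem
          obtain ⟨hzS, hzl⟩ := Finset.mem_filter.1 hz
          obtain ⟨z, rfl⟩ := Sum.isLeft_iff.1 hzl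
          exact hvS ((Subtype.ext hzv : z = v) ▸ hzS)
        · let w' : W := ⟨w, hNW hvF hw⟩
          have hadj : H.Adj (Sum.inl v) (Sum.inl w') :=
            ⟨fun heq => hw.ne (congrArg φ heq), .inr ⟨v, w', rfl, rfl, hw⟩⟩
          rcases hclosed _ hadj with hmem | hmem
          · exact .inl (Finset.mem_image.2 ⟨_, hmem, rfl⟩)
          · exact .inr (Finset.mem_image.2 ⟨_, Finset.mem_filter.2 ⟨hmem, rfl⟩, rfl⟩)
  choose p hp hpu using fun x => hM.1 (hM.2 x)
  have hpp (x) : p (p x) = x := (hpu _ _ (hp x).symm).symm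
  refine ⟨fun v => if hv : v ∈ W then φ (p (Sum.inl ⟨v, hv⟩)) else v, fun v hv => ?_⟩
  obtain ⟨w, hw, hvw⟩ := hHB (v := ⟨v, hFW hv⟩) hv (hp (Sum.inl ⟨v, hFW hv⟩)).adj_sub
  have hw' : p (Sum.inl w) = Sum.inl ⟨v, hFW hv⟩ := by rw [← hw, hpp]
  simp only [hFW hv, dite_true, hw]
  exact ⟨hvw, by simp [φ, hw']⟩

/-- Tutte's condition on finite sets guarantees a perfect matching in any locally finite graph. -/
lemma exists_partner (h : ∀ S 𝒞, IsOddBarrier G S 𝒞 → 𝒞.card ≤ S.card) :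
    ∃ g : V → V, ∀ v, G.Adj v (g v) ∧ g (g v) = v := by
  choose p hp using exists_partial_partner h
  let 𝒰 : Ultrafilter (Finset V) := Ultrafilter.of Filter.atTop
  have hmem (v : V) : ∀ᶠ F in (𝒰 : Filter (Finset V)), v ∈ F :=
    Ultrafilter.of_le _ ((Filter.eventually_ge_atTop {v}).mono fun F hF => by simpa using hF)
  have hlim (v : V) : ∃ w, ∀ᶠ F in (𝒰 : Filter (Finset V)), p F v = w := by
    have : ∀ᶠ F in (𝒰 : Filter (Finset V)), ∃ w ∈ G.neighborSet v, p F v = w :=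
      (hmem v).mono fun F hF => ⟨_, (hp F v hF).1, rfl⟩
    obtain ⟨w, -, hw⟩ :=
      (Ultrafilter.eventually_exists_mem_iff (Set.toFinite (G.neighborSet v))).1 this
    exact ⟨w, hw⟩
  choose g hg using hlim
  refine ⟨g, fun v => ?_⟩
  obtain ⟨F, hv, h₁, h₂⟩ := ((hmem v).and ((hg v).and (hg (g v)))).exists
  have := hp F v hv
  rwa [h₁, h₂] at this

end Compactness

lemma isPM_range_of_partner {G : SimpleGraph V} {g : V → V}
    (hg : ∀ v, G.Adj v (g v) ∧ g (g v) = v) : IsPM G (Set.range fun v => s(v, g v)) := by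
  refine ⟨?_, fun v => ⟨s(v, g v), ⟨⟨v, rfl⟩, Sym2.mem_mk_left _ _⟩, ?_⟩⟩
  · rintro _ ⟨v, rfl⟩
    exact (hg v).1
  · rintro _ ⟨⟨w, rfl⟩, hv⟩
    rcases Sym2.mem_iff.1 hv with rfl | rfl
    · rfl
    · simp only [(hg w).2]
      exact Sym2.eq_swap

lemma IsPM.mono {G G' : SimpleGraph V} (hle : G ≤ G') {M : Set (Sym2 V)} (hM : IsPM G M) :
    IsPM G' M :=
  ⟨hM.1.trans (edgeSet_mono hle), hM.2⟩

lemma exists_isPM_avoiding_two {G : SimpleGraph V} (hcubic : CubicGraph G) (hbl : Bridgeless G)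
    (e f : Sym2 V) : ∃ M, IsPM G M ∧ e ∉ M ∧ f ∉ M := by
  have hfin (v : V) : (G.neighborSet v).Finite := Set.finite_of_ncard_ne_zero (by simp [hcubic v])
  let : G.LocallyFinite := fun v => (hfin v).fintype
  let : (G.deleteEdges {e, f}).LocallyFinite := fun v =>
    ((hfin v).subset fun w hw => deleteEdges_le _ hw).fintype
  have hd : G.IsRegularOfDegree 3 := fun v => by
    rw [← hcubic v, ← card_neighborSet_eq_degree, Set.ncard_eq_toFinset_card', Set.toFinset_card]
  obtain ⟨g, hg⟩ := exists_partner (G := G.deleteEdges {e, f}) fun S 𝒞 h => h.card_le hd hbl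
  have hM := isPM_range_of_partner hg
  have hnot : ∀ x ∈ ({e, f} : Set (Sym2 V)), x ∉ Set.range fun v => s(v, g v) := by
    intro x hx hxM
    have := hM.1 hxM
    rw [edgeSet_deleteEdges] at this
    exact this.2 hx
  exact ⟨_, hM.mono (deleteEdges_le _), hnot e (by simp), hnot f (by simp)⟩

/-- Every cubic bridgeless graph is matching-covered, and moreover for any two edges
`e` and `f` there is a perfect matching avoiding both. -/
theorem cubic_bridgeless_matching_covered_and_two_avoided
    (G : SimpleGraph V) (hcubic : CubicGraph G) (hbl : Bridgeless G) :
    (∀ e ∈ G.edgeSet, ∃ M, IsPM G M ∧ e ∈ M) ∧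
    (∀ e ∈ G.edgeSet, ∀ f ∈ G.edgeSet, ∃ M, IsPM G M ∧ e ∉ M ∧ f ∉ M) := by
  refine ⟨fun e he => ?_, fun e _ f _ => exists_isPM_avoiding_two hcubic hbl e f⟩
  induction e with | _ x y
  obtain ⟨a, b, hab⟩ : ∃ a b, G.neighborSet x = {y, a, b} := by
    have hcard : (G.neighborSet x \ {y}).ncard = 2 := by
      rw [Set.ncard_sdiff_singleton_of_mem (show y ∈ G.neighborSet x from he), hcubic x]
    obtain ⟨a, b, -, hab⟩ := Set.ncard_eq_two.1 hcard
    exact ⟨a, b, by rw [← hab, Set.insert_sdiff_self_of_mem (show y ∈ G.neighborSet x from he)]⟩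
  obtain ⟨M, hM, ha, hb⟩ := exists_isPM_avoiding_two hcubic hbl s(x, a) s(x, b)
  refine ⟨M, hM, ?_⟩
  obtain ⟨e, ⟨heM, hxe⟩, -⟩ := hM.2 x
  obtain ⟨z, rfl⟩ := Sym2.mem_iff_exists.1 hxe
  have hz : z ∈ G.neighborSet x := hM.1 heM
  rw [hab] at hz
  rcases hz with rfl | rfl | rfl
  · exact heM
  · exact absurd heM ha
  · exact absurd heM hb
end

section
/- Let G be a bipartite twisted net with n vertices. Then G has two corners u₁, u₂ in one color class and two corners v₁, v₂ in the other; the graph G minus all four corners has a perfect matching; for every i, j ∈ {1,2} the graph G \ {u_i, v_j} has a perfect matching; and for some i, j ∈ {1,2} the graph G \ {u_i, v_j} has at least 2^(n/18 − 2/9) perfect matchings. -/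
open SimpleGraph
open scoped Classical

universe u

variable {V : Type u}

/-- `M` is a matching of `G` covering exactly the vertices of `S`. -/
def IsMatchingOn (G : SimpleGraph V) (S : Set V) (M : Set (Sym2 V)) : Prop :=
  (∀ e ∈ M, ∃ x y, e = s(x, y) ∧ G.Adj x y ∧ x ∈ S ∧ y ∈ S) ∧ ∀ w ∈ S, ∃! e, e ∈ M ∧ w ∈ e

/-- The number of matchings of `G` covering exactly the vertices of `S`. -/
noncomputable def numMatchingsOn (G : SimpleGraph V) (S : Set V) : ℕ :=
  {M | IsMatchingOn G S M}.ncard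

theorem isNearPM_iff_isMatchingOn (G : SimpleGraph V) (A X : Set V) (M : Set (Sym2 V)) :
    IsNearPM G A X M ↔ IsMatchingOn G (A \ X) M := by
  constructor
  · rintro ⟨h₁, h₂, h₃⟩
    refine ⟨fun e he => ?_, h₂⟩
    obtain ⟨x, y, rfl, hxy, hx, hy⟩ := h₁ e he
    exact ⟨x, y, rfl, hxy, ⟨hx, fun hX => h₃ x hX _ he (by simp)⟩,
      ⟨hy, fun hX => h₃ y hX _ he (by simp)⟩⟩
  · rintro ⟨h₁, h₂⟩
    refine ⟨fun e he => ?_, h₂, fun w hw e he hwe => ?_⟩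
    · obtain ⟨x, y, rfl, hxy, hx, hy⟩ := h₁ e he
      exact ⟨x, y, rfl, hxy, hx.1, hy.1⟩
    · obtain ⟨x, y, rfl, hxy, hx, hy⟩ := h₁ e he
      rcases Sym2.mem_iff.1 hwe with rfl | rfl
      · exact hx.2 hw
      · exact hy.2 hw

namespace IsMatchingOn

variable {G : SimpleGraph V} {S T : Set V} {M N : Set (Sym2 V)} {e : Sym2 V} {p q w : V}

theorem mem_of_mem (h : IsMatchingOn G S M) (he : e ∈ M) (hw : w ∈ e) : w ∈ S := by
  obtain ⟨x, y, rfl, -, hx, hy⟩ := h.1 e he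
  rcases Sym2.mem_iff.1 hw with rfl | rfl <;> assumption

theorem exists_mem (h : IsMatchingOn G S M) (he : e ∈ M) : ∃ w ∈ e, w ∈ S := by
  obtain ⟨x, y, rfl, -, hx, hy⟩ := h.1 e he
  exact ⟨x, by simp, hx⟩

theorem empty (G : SimpleGraph V) : IsMatchingOn G ∅ ∅ := by simp [IsMatchingOn]

theorem pair (hpq : G.Adj p q) : IsMatchingOn G {p, q} {s(p, q)} := by
  refine ⟨fun e he => ⟨p, q, he, hpq, by simp, by simp⟩, fun w hw => ⟨s(p, q), ⟨rfl, ?_⟩, ?_⟩⟩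
  · simpa using hw
  · rintro e ⟨he, -⟩
    exact he

theorem union (hM : IsMatchingOn G S M) (hN : IsMatchingOn G T N) (hST : Disjoint S T) :
    IsMatchingOn G (S ∪ T) (M ∪ N) := by
  rw [Set.disjoint_left] at hST
  refine ⟨?_, ?_⟩
  · rintro e (he | he)
    · obtain ⟨x, y, rfl, hxy, hx, hy⟩ := hM.1 e he
      exact ⟨x, y, rfl, hxy, .inl hx, .inl hy⟩
    · obtain ⟨x, y, rfl, hxy, hx, hy⟩ := hN.1 e he
      exact ⟨x, y, rfl, hxy, .inr hx, .inr hy⟩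
  · rintro w (hw | hw)
    · obtain ⟨e, ⟨he, hwe⟩, huniq⟩ := hM.2 w hw
      refine ⟨e, ⟨.inl he, hwe⟩, ?_⟩
      rintro e' ⟨he' | he', hwe'⟩
      · exact huniq e' ⟨he', hwe'⟩
      · exact (hST hw (hN.mem_of_mem he' hwe')).elim
    · obtain ⟨e, ⟨he, hwe⟩, huniq⟩ := hN.2 w hw
      refine ⟨e, ⟨.inr he, hwe⟩, ?_⟩
      rintro e' ⟨he' | he', hwe'⟩
      · exact (hST (hM.mem_of_mem he' hwe') hw).elim
      · exact huniq e' ⟨he', hwe'⟩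

theorem setOf_mem_union_eq (hM : IsMatchingOn G S M) (hN : IsMatchingOn G T N)
    (hST : Disjoint S T) : {e ∈ M ∪ N | ∃ w ∈ e, w ∈ S} = M := by
  rw [Set.disjoint_left] at hST
  ext e
  constructor
  · rintro ⟨he | he, w, hw, hwS⟩
    · exact he
    · exact (hST hwS (hN.mem_of_mem he hw)).elim
  · exact fun he => ⟨.inl he, hM.exists_mem he⟩

end IsMatchingOn

theorem injOn_union_isMatchingOn {G : SimpleGraph V} {S T : Set V} (hST : Disjoint S T) :
    Set.InjOn (fun P : Set (Sym2 V) × Set (Sym2 V) => P.1 ∪ P.2)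
      ({M | IsMatchingOn G S M} ×ˢ {N | IsMatchingOn G T N}) := by
  rintro ⟨M, N⟩ ⟨hM, hN⟩ ⟨M', N'⟩ ⟨hM', hN'⟩ h
  simp only [Set.mem_ofPred_eq] at hM hN hM' hN' h
  ext1
  · rw [← hM.setOf_mem_union_eq hN hST, h, hM'.setOf_mem_union_eq hN' hST]
  · rw [← hN.setOf_mem_union_eq hM hST.symm, Set.union_comm, h, Set.union_comm,
      hN'.setOf_mem_union_eq hM' hST.symm]

section Counting

variable [Finite V] {G : SimpleGraph V} {S T : Set V} {p q p' q' : V}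

theorem one_le_numMatchingsOn_empty (G : SimpleGraph V) : 1 ≤ numMatchingsOn G ∅ :=
  (Set.ncard_pos).2 ⟨∅, IsMatchingOn.empty G⟩

theorem one_le_numMatchingsOn_pair (hpq : G.Adj p q) : 1 ≤ numMatchingsOn G {p, q} :=
  (Set.ncard_pos).2 ⟨_, IsMatchingOn.pair hpq⟩

theorem numMatchingsOn_mul_le (hST : Disjoint S T) :
    numMatchingsOn G S * numMatchingsOn G T ≤ numMatchingsOn G (S ∪ T) := by
  rw [numMatchingsOn, numMatchingsOn, ← Set.ncard_prod,
    ← (injOn_union_isMatchingOn hST).ncard_image]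
  refine Set.ncard_le_ncard ?_
  rintro _ ⟨⟨M, N⟩, ⟨hM, hN⟩, rfl⟩
  exact hM.union hN hST

theorem numMatchingsOn_le_union_pair (hpq : G.Adj p q) (hp : p ∉ S) (hq : q ∉ S) :
    numMatchingsOn G S ≤ numMatchingsOn G (S ∪ {p, q}) := by
  have h := numMatchingsOn_mul_le (G := G) (S := S) (T := {p, q}) (by simp [hp, hq])
  exact (Nat.le_mul_of_pos_right _ (one_le_numMatchingsOn_pair hpq)).trans h

/-- Matchings using an edge `pq` between `S` and `T`, together with those using no edge
between `S` and `T`. -/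
theorem numMatchingsOn_add_mul_le (hST : Disjoint S T) (hpq : G.Adj p q) (hp : p ∈ S)
    (hq : q ∈ T) :
    numMatchingsOn G ((S ∪ T) \ {p, q}) + numMatchingsOn G S * numMatchingsOn G T ≤
      numMatchingsOn G (S ∪ T) := by
  have hd : Disjoint ((S ∪ T) \ {p, q}) {p, q} := Set.disjoint_sdiff_left
  have hinj : Set.InjOn (fun M => M ∪ {s(p, q)})
      {M | IsMatchingOn G ((S ∪ T) \ {p, q}) M} := by
    intro M hM M' hM' h
    simp only [Set.mem_ofPred_eq] at hM hM' h
    rw [← hM.setOf_mem_union_eq (.pair hpq) hd, h, hM'.setOf_mem_union_eq (.pair hpq) hd]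
  rw [numMatchingsOn, numMatchingsOn, numMatchingsOn, ← Set.ncard_prod,
    ← (injOn_union_isMatchingOn hST).ncard_image,
    ← hinj.ncard_image, ← Set.ncard_union_eq]
  · refine Set.ncard_le_ncard ?_
    rintro _ (⟨M, hM, rfl⟩ | ⟨⟨M, N⟩, ⟨hM, hN⟩, rfl⟩)
    · have h := IsMatchingOn.union hM (.pair hpq) hd
      rwa [Set.sdiff_union_of_subset] at h
      rintro x (rfl | rfl)
      exacts [.inl hp, .inr hq]
    · exact hM.union hN hST
  · rw [Set.disjoint_left] at hST ⊢
    rintro _ ⟨M, hM, rfl⟩ ⟨⟨N, N'⟩, ⟨hN, hN'⟩, h⟩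
    have hmem : s(p, q) ∈ N ∪ N' := by
      rw [show N ∪ N' = M ∪ {s(p, q)} from h]
      simp
    rcases hmem with h | h
    · exact hST (IsMatchingOn.mem_of_mem hN h (Sym2.mem_mk_right p q)) hq
    · exact hST hp (IsMatchingOn.mem_of_mem hN' h (Sym2.mem_mk_left p q))

theorem numMatchingsOn_mul_le_edge (hST : Disjoint S T) (hpq : G.Adj p q)
    (hp : p ∉ S ∪ T) (hq : q ∉ S ∪ T) :
    numMatchingsOn G S * numMatchingsOn G T ≤ numMatchingsOn G (S ∪ T ∪ {p, q}) :=
  (numMatchingsOn_mul_le hST).trans (numMatchingsOn_le_union_pair hpq hp hq)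

/-- Matchings using both of two disjoint edges between `S` and `T`, together with those using
no edge between `S` and `T`. -/
theorem numMatchingsOn_mul_add_mul_le (hST : Disjoint S T) (hpq : G.Adj p q)
    (hpq' : G.Adj p' q') (hp : p ∈ S) (hp' : p' ∈ S) (hq : q ∈ T) (hq' : q' ∈ T) (hpp : p ≠ p')
    (hqq : q ≠ q') :
    numMatchingsOn G (S \ {p, p'}) * numMatchingsOn G (T \ {q, q'}) +
      numMatchingsOn G S * numMatchingsOn G T ≤ numMatchingsOn G (S ∪ T) := by
  have hd := Set.disjoint_left.1 hST
  have h₁ := numMatchingsOn_add_mul_le hST hpq hp hq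
  have h₂ := numMatchingsOn_mul_le_edge (S := S \ {p, p'}) (T := T \ {q, q'})
    (hST.mono Set.sdiff_subset Set.sdiff_subset) hpq' (by grind) (by grind)
  rw [show S \ {p, p'} ∪ T \ {q, q'} ∪ {p', q'} = (S ∪ T) \ {p, q} by grind] at h₂
  omega

/-- Matchings using exactly one of two given disjoint edges between `S` and `T`. -/
theorem numMatchingsOn_mul_add_mul_le' (hST : Disjoint S T) (hpq : G.Adj p q)
    (hpq' : G.Adj p' q') (hp : p ∈ S) (hp' : p' ∈ S) (hq : q ∈ T) (hq' : q' ∈ T) (hpp : p ≠ p') :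
    numMatchingsOn G (S \ {p}) * numMatchingsOn G (T \ {q}) +
      numMatchingsOn G (S \ {p'}) * numMatchingsOn G (T \ {q'}) ≤ numMatchingsOn G (S ∪ T) := by
  have hd := Set.disjoint_left.1 hST
  have h₁ := numMatchingsOn_add_mul_le (S := S \ {p'}) (T := T \ {q'} ∪ {p', q'})
    (by rw [Set.disjoint_left]; grind) hpq (by grind) (by grind)
  have h₂ := numMatchingsOn_mul_le (G := G) (S := S \ {p}) (T := T \ {q})
    (hST.mono Set.sdiff_subset Set.sdiff_subset)
  have h₃ := numMatchingsOn_le_union_pair (S := T \ {q'}) hpq' (by grind) (by grind)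
  have h₄ := Nat.mul_le_mul_left (numMatchingsOn G (S \ {p'})) h₃
  rw [show S \ {p'} ∪ (T \ {q'} ∪ {p', q'}) = S ∪ T by grind] at h₁
  rw [show S \ {p} ∪ T \ {q} = (S ∪ T) \ {p, q} by grind] at h₂
  omega

end Counting

/-- The inequalities maintained for lower bounds on the numbers of matchings of a bipartite
twisted net on `n` vertices: `f` for matchings covering all vertices, `e` for those missing all
four corners, and `mᵢⱼ` for those missing the `i`-th corner of the first colour class and the
`j`-th of the second. -/
structure NetNumbers (n f e m₁₁ m₁₂ m₂₁ m₂₂ : ℕ) : Prop where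
  f_pos : 0 < f
  e_pos : 0 < e
  pos₁₁ : 0 < m₁₁
  pos₁₂ : 0 < m₁₂
  pos₂₁ : 0 < m₂₁
  pos₂₂ : 0 < m₂₂
  full_le : f * e ≤ m₁₁ * m₂₂ + m₁₂ * m₂₁
  diag_le : m₁₁ * m₂₂ ≤ f * e + m₁₂ * m₂₁
  anti_le : m₁₂ * m₂₁ ≤ f * e + m₁₁ * m₂₂
  growth : 2 ^ n ≤ 4 * (f ^ 2 * e * (m₁₁ * m₁₂ * m₂₁ * m₂₂) ^ 2)

theorem mul_add_mul_le_of_triangle {x y z X Y Z : ℕ} (h₁ : x ≤ y + z) (h₂ : y ≤ x + z)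
    (H₁ : X ≤ Y + Z) (H₂ : Y ≤ X + Z) : x * X + y * Y ≤ x * Y + y * X + z * Z := by
  zify at *
  have h : |(x : ℤ) - y| ≤ z := abs_le.2 ⟨by linarith, by linarith⟩
  have H : |(X : ℤ) - Y| ≤ Z := abs_le.2 ⟨by linarith, by linarith⟩
  have hm := mul_le_mul h H (abs_nonneg _) (by positivity)
  rw [← abs_mul] at hm
  linarith [(abs_le.1 hm).2]

namespace NetNumbers

variable {n f e a b c d n' f' e' a' b' c' d' : ℕ}

theorem swap_left (h : NetNumbers n f e a b c d) : NetNumbers n f e c d a b where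
  f_pos := h.f_pos
  e_pos := h.e_pos
  pos₁₁ := h.pos₂₁
  pos₁₂ := h.pos₂₂
  pos₂₁ := h.pos₁₁
  pos₂₂ := h.pos₁₂
  full_le := by linarith [h.full_le]
  diag_le := by linarith [h.anti_le]
  anti_le := by linarith [h.diag_le]
  growth := by convert h.growth using 4; ring

theorem swap_right (h : NetNumbers n f e a b c d) : NetNumbers n f e b a d c where
  f_pos := h.f_pos
  e_pos := h.e_pos
  pos₁₁ := h.pos₁₂
  pos₁₂ := h.pos₁₁
  pos₂₁ := h.pos₂₂
  pos₂₂ := h.pos₂₁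
  full_le := by linarith [h.full_le]
  diag_le := by linarith [h.anti_le]
  anti_le := by linarith [h.diag_le]
  growth := by convert h.growth using 4; ring

theorem four_cycle : NetNumbers 4 2 1 1 1 1 1 := by
  constructor <;> norm_num

theorem incr (h : NetNumbers n f e a b c d) :
    NetNumbers (n + 2) (f + a) d (d + e) c b f := by
  obtain ⟨hf, he, ha, hb, hc, hd, h₁, h₂, h₃, hg⟩ := h
  refine ⟨by positivity, by positivity, by positivity, by positivity, by positivity, by positivity,
    by nlinarith, by nlinarith, by nlinarith, ?_⟩
  have h₄ : 4 * d * e ≤ (d + e) ^ 2 := four_mul_le_sq_add d e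
  have h₅ : a ^ 2 ≤ (f + a) ^ 2 := by gcongr; omega
  calc 2 ^ (n + 2) = 4 * 2 ^ n := by ring
    _ ≤ 4 * (4 * (f ^ 2 * e * (a * b * c * d) ^ 2)) := by gcongr
    _ = 4 * (a ^ 2 * d * ((4 * d * e) * (c * b * f) ^ 2)) := by ring
    _ ≤ 4 * ((f + a) ^ 2 * d * ((d + e) ^ 2 * (c * b * f) ^ 2)) := by gcongr
    _ = _ := by ring

theorem growth_mul (h : NetNumbers n f e a b c d) (h' : NetNumbers n' f' e' a' b' c' d') :
    2 ^ (n + n') ≤ 4 * (64 * (f ^ 2 * e * (a * b * c * d) ^ 2) *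
      (f' ^ 2 * e' * (a' * b' * c' * d') ^ 2)) := by
  have hm := Nat.mul_le_mul h.growth h'.growth
  rw [← pow_add] at hm
  refine hm.trans ?_
  nlinarith [Nat.zero_le ((f ^ 2 * e * (a * b * c * d) ^ 2) *
      (f' ^ 2 * e' * (a' * b' * c' * d') ^ 2))]

theorem mul_mixed (h : NetNumbers n f e a b c d) (h' : NetNumbers n' f' e' a' b' c' d') :
    NetNumbers (n + n') (f * f' + a * a') (d * d' + e * e') (d * f' + e * a') (c * b')
      (b * c') (f * d' + a * e') := by
  have hg := growth_mul h h'
  obtain ⟨hf, he, ha, hb, hc, hd, h₁, h₂, h₃, -⟩ := h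
  obtain ⟨hf', he', ha', hb', hc', hd', h₁', h₂', h₃', -⟩ := h'
  refine ⟨by positivity, by positivity, by positivity, by positivity, by positivity, by positivity,
    ?_, ?_, ?_, ?_⟩
  · nlinarith [mul_add_mul_le_of_triangle h₁ h₂ h₁' h₂']
  · have := mul_add_mul_le_of_triangle (X := a' * d') (Y := f' * e') h₁ h₂ h₂' h₁'
    nlinarith
  · have := Nat.mul_le_mul h₃ h₃'
    have h₀ : 0 ≤ f * f' * d * d' + a * a' * e * e' := by positivity
    nlinarith
  · have k₁ := four_mul_le_sq_add (f * f') (a * a')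
    have k₂ : d * d' ≤ d * d' + e * e' := by omega
    have k₃ := four_mul_le_sq_add (d * f') (e * a')
    have k₄ := four_mul_le_sq_add (f * d') (a * e')
    refine hg.trans ?_
    calc _ = 4 * (4 * (f * f') * (a * a') * (d * d') * ((4 * (d * f') * (e * a')) *
          (4 * (f * d') * (a * e')) * (c * b' * (b * c')) ^ 2)) := by ring
      _ ≤ 4 * ((f * f' + a * a') ^ 2 * (d * d' + e * e') * ((d * f' + e * a') ^ 2 *
          (f * d' + a * e') ^ 2 * (c * b' * (b * c')) ^ 2)) := by gcongr
      _ = _ := by ring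

theorem mul_same (h : NetNumbers n f e a b c d) (h' : NetNumbers n' f' e' a' b' c' d') :
    NetNumbers (n + n') (f * f') (e * e') (a * a' + c * b') (b * a' + d * b')
      (a * c' + c * d') (b * c' + d * d') := by
  have hg := growth_mul h h'
  obtain ⟨hf, he, ha, hb, hc, hd, h₁, h₂, h₃, -⟩ := h
  obtain ⟨hf', he', ha', hb', hc', hd', h₁', h₂', h₃', -⟩ := h'
  refine ⟨by positivity, by positivity, by positivity, by positivity, by positivity, by positivity,
    ?_, ?_, ?_, ?_⟩
  · have := Nat.mul_le_mul h₁ h₁'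
    have h₀ : 0 ≤ a * b * a' * c' + c * d * b' * d' := by positivity
    nlinarith
  · have := mul_add_mul_le_of_triangle (x := a * d) (y := b * c) (z := f * e)
      (X := a' * d') (Y := b' * c') (Z := f' * e') (by linarith) (by linarith) (by linarith)
      (by linarith)
    nlinarith
  · have := mul_add_mul_le_of_triangle (x := b * c) (y := a * d) (z := f * e)
      (X := a' * d') (Y := b' * c') (Z := f' * e') (by linarith) (by linarith) (by linarith)
      (by linarith)
    nlinarith
  · have k₁ := four_mul_le_sq_add (a * a') (c * b')
    have k₂ := four_mul_le_sq_add (b * a') (d * b')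
    have k₃ := four_mul_le_sq_add (a * c') (c * d')
    have k₄ := four_mul_le_sq_add (b * c') (d * d')
    refine hg.trans ?_
    calc _ ≤ 4 * (256 * (f ^ 2 * e * (a * b * c * d) ^ 2) *
          (f' ^ 2 * e' * (a' * b' * c' * d') ^ 2)) := by gcongr; norm_num
      _ = 4 * ((f * f') ^ 2 * (e * e') * ((4 * (a * a') * (c * b')) * (4 * (b * a') * (d * b')) *
          (4 * (a * c') * (c * d')) * (4 * (b * c') * (d * d')))) := by ring
      _ ≤ 4 * ((f * f') ^ 2 * (e * e') * ((a * a' + c * b') ^ 2 * (b * a' + d * b') ^ 2 *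
          (a * c' + c * d') ^ 2 * (b * c' + d * d') ^ 2)) := by gcongr
      _ = _ := by ring

theorem two_pow_le_of_le (h : NetNumbers n f e a b c d) {m : ℕ} (ha : a ≤ m) (hb : b ≤ m)
    (hc : c ≤ m) (hd : d ≤ m) : 2 ^ n ≤ 16 * m ^ 18 := by
  have hm : 1 ≤ m := h.pos₁₁.trans_le ha
  have hfe : f * e ≤ 2 * m ^ 2 := by
    have := Nat.mul_le_mul ha hd
    have := Nat.mul_le_mul hb hc
    nlinarith [h.full_le]
  calc 2 ^ n ≤ 4 * (f ^ 2 * e * (a * b * c * d) ^ 2) := h.growth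
    _ ≤ 4 * (f ^ 2 * e ^ 2 * (m * m * m * m) ^ 2) := by
      gcongr
      exact Nat.le_self_pow two_ne_zero e
    _ = 4 * ((f * e) ^ 2 * m ^ 8) := by ring
    _ ≤ 4 * ((2 * m ^ 2) ^ 2 * m ^ 8) := by gcongr
    _ = 16 * m ^ 12 := by ring
    _ ≤ 16 * m ^ 18 := by gcongr; omega

end NetNumbers

/-- The vertex set `st` carries corners `a₁, a₂` in `C` and `b₁, b₂` outside `C`, together with
lower bounds for its numbers of matchings satisfying `NetNumbers`. -/
structure IsBalancedNet (G : SimpleGraph V) (C st : Set V) (a₁ a₂ b₁ b₂ : V) : Prop where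
  ma₁ : a₁ ∈ st
  ma₂ : a₂ ∈ st
  mb₁ : b₁ ∈ st
  mb₂ : b₂ ∈ st
  ca₁ : a₁ ∈ C
  ca₂ : a₂ ∈ C
  cb₁ : b₁ ∉ C
  cb₂ : b₂ ∉ C
  ne_a : a₁ ≠ a₂
  ne_b : b₁ ≠ b₂
  exists_numbers : ∃ f e m₁₁ m₁₂ m₂₁ m₂₂, NetNumbers st.ncard f e m₁₁ m₁₂ m₂₁ m₂₂ ∧
    f ≤ numMatchingsOn G st ∧ e ≤ numMatchingsOn G (st \ {a₁, a₂, b₁, b₂}) ∧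
    m₁₁ ≤ numMatchingsOn G (st \ {a₁, b₁}) ∧ m₁₂ ≤ numMatchingsOn G (st \ {a₁, b₂}) ∧
    m₂₁ ≤ numMatchingsOn G (st \ {a₂, b₁}) ∧ m₂₂ ≤ numMatchingsOn G (st \ {a₂, b₂})

namespace IsBalancedNet

variable {G : SimpleGraph V} {C st st' : Set V} {a₁ a₂ b₁ b₂ a₁' a₂' b₁' b₂' u u' v v' : V}

theorem swap_left (h : IsBalancedNet G C st a₁ a₂ b₁ b₂) : IsBalancedNet G C st a₂ a₁ b₁ b₂ := by
  obtain ⟨h₁, h₂, h₃, h₄, h₅, h₆, h₇, h₈, h₉, h₁₀, f, e, a, b, c, d, hn, kf, ke, ka, kb, kc, kd⟩ := h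
  exact ⟨h₂, h₁, h₃, h₄, h₆, h₅, h₇, h₈, h₉.symm, h₁₀, f, e, c, d, a, b, hn.swap_left, kf,
    by rwa [Set.insert_comm], kc, kd, ka, kb⟩

theorem swap_right (h : IsBalancedNet G C st a₁ a₂ b₁ b₂) : IsBalancedNet G C st a₁ a₂ b₂ b₁ := by
  obtain ⟨h₁, h₂, h₃, h₄, h₅, h₆, h₇, h₈, h₉, h₁₀, f, e, a, b, c, d, hn, kf, ke, ka, kb, kc, kd⟩ := h
  exact ⟨h₁, h₂, h₄, h₃, h₅, h₆, h₈, h₇, h₉, h₁₀.symm, f, e, b, a, d, c, hn.swap_right, kf,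
    by rwa [Set.pair_comm], kb, ka, kd, kc⟩

theorem exists_left (h : IsBalancedNet G C st a₁ a₂ b₁ b₂)
    (hu : u ∈ ({a₁, a₂, b₁, b₂} : Set V)) (huC : u ∈ C) :
    ∃ a, IsBalancedNet G C st u a b₁ b₂ ∧ ({a₁, a₂, b₁, b₂} : Set V) = {u, a, b₁, b₂} := by
  rcases hu with rfl | rfl | rfl | rfl
  · exact ⟨a₂, h, rfl⟩
  · exact ⟨a₁, h.swap_left, Set.insert_comm _ _ _⟩
  · exact (h.cb₁ huC).elim
  · exact (h.cb₂ huC).elim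

theorem exists_right (h : IsBalancedNet G C st a₁ a₂ b₁ b₂)
    (hu : u ∈ ({a₁, a₂, b₁, b₂} : Set V)) (huC : u ∉ C) :
    ∃ b, IsBalancedNet G C st a₁ a₂ u b ∧ ({a₁, a₂, b₁, b₂} : Set V) = {a₁, a₂, u, b} := by
  rcases hu with rfl | rfl | rfl | rfl
  · exact (huC h.ca₁).elim
  · exact (huC h.ca₂).elim
  · exact ⟨b₂, h, rfl⟩
  · exact ⟨b₁, h.swap_right, by rw [Set.pair_comm]⟩

theorem exists_mixed (h : IsBalancedNet G C st a₁ a₂ b₁ b₂)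
    (hu : u ∈ ({a₁, a₂, b₁, b₂} : Set V)) (huC : u ∈ C)
    (hu' : u' ∈ ({a₁, a₂, b₁, b₂} : Set V)) (huC' : u' ∉ C) :
    ∃ a b, IsBalancedNet G C st u a u' b ∧ ({a₁, a₂, b₁, b₂} : Set V) = {u, a, u', b} := by
  obtain ⟨a, h₁, e₁⟩ := h.exists_left hu huC
  rw [e₁] at hu' ⊢
  obtain ⟨b, h₂, e₂⟩ := h₁.exists_right hu' huC'
  exact ⟨a, b, h₂, e₂⟩

theorem exists_both_left (h : IsBalancedNet G C st a₁ a₂ b₁ b₂)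
    (hu : u ∈ ({a₁, a₂, b₁, b₂} : Set V)) (huC : u ∈ C)
    (hu' : u' ∈ ({a₁, a₂, b₁, b₂} : Set V)) (huC' : u' ∈ C) (hne : u ≠ u') :
    IsBalancedNet G C st u u' b₁ b₂ ∧ ({a₁, a₂, b₁, b₂} : Set V) = {u, u', b₁, b₂} := by
  obtain ⟨a, h₁, e₁⟩ := h.exists_left hu huC
  rw [e₁] at hu' ⊢
  rcases hu' with rfl | rfl | rfl | rfl
  · exact (hne rfl).elim
  · exact ⟨h₁, rfl⟩
  · exact (h.cb₁ huC').elim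
  · exact (h.cb₂ huC').elim

theorem exists_both_right (h : IsBalancedNet G C st a₁ a₂ b₁ b₂)
    (hu : u ∈ ({a₁, a₂, b₁, b₂} : Set V)) (huC : u ∉ C)
    (hu' : u' ∈ ({a₁, a₂, b₁, b₂} : Set V)) (huC' : u' ∉ C) (hne : u ≠ u') :
    IsBalancedNet G C st a₁ a₂ u u' ∧ ({a₁, a₂, b₁, b₂} : Set V) = {a₁, a₂, u, u'} := by
  obtain ⟨b, h₁, e₁⟩ := h.exists_right hu huC
  rw [e₁] at hu' ⊢
  rcases hu' with rfl | rfl | rfl | rfl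
  · exact (huC' h.ca₁).elim
  · exact (huC' h.ca₂).elim
  · exact (hne rfl).elim
  · exact ⟨h₁, rfl⟩

variable [Finite V]

theorem four_cycle (hab : G.Adj a₁ b₁) (hba : G.Adj b₁ a₂) (hab' : G.Adj a₂ b₂)
    (hba' : G.Adj b₂ a₁) (ha : a₁ ≠ a₂) (hb : b₁ ≠ b₂) (ca₁ : a₁ ∈ C) (ca₂ : a₂ ∈ C)
    (cb₁ : b₁ ∉ C) (cb₂ : b₂ ∉ C) : IsBalancedNet G C {a₁, b₁, a₂, b₂} a₁ a₂ b₁ b₂ := by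
  have h₁₁ : a₁ ≠ b₁ := hab.ne
  have h₁₂ : a₁ ≠ b₂ := hba'.ne'
  have h₂₁ : a₂ ≠ b₁ := hba.ne'
  have h₂₂ : a₂ ≠ b₂ := hab'.ne
  refine ⟨by simp, by simp, by simp, by simp, ca₁, ca₂, cb₁, cb₂, ha, hb, 2, 1, 1, 1, 1, 1, ?_,
    ?_, ?_, ?_, ?_, ?_, ?_⟩
  · rw [show ({a₁, b₁, a₂, b₂} : Set V).ncard = 4 by
      rw [Set.ncard_eq_toFinset_card']
      simp [*, h₂₁.symm]]
    exact NetNumbers.four_cycle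
  · have h := numMatchingsOn_add_mul_le (S := {a₁, b₁}) (T := {a₂, b₂})
      (by rw [Set.disjoint_left]; grind) hba'.symm (by simp) (by simp)
    rw [show (({a₁, b₁} : Set V) ∪ {a₂, b₂}) \ {a₁, b₂} = {b₁, a₂} by grind,
      show (({a₁, b₁} : Set V) ∪ {a₂, b₂}) = {a₁, b₁, a₂, b₂} by grind] at h
    have k₁ := one_le_numMatchingsOn_pair hba
    have k₂ := Nat.mul_le_mul (one_le_numMatchingsOn_pair hab) (one_le_numMatchingsOn_pair hab')
    omega
  · rw [show ({a₁, b₁, a₂, b₂} : Set V) \ {a₁, a₂, b₁, b₂} = ∅ by grind]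
    exact one_le_numMatchingsOn_empty G
  · rw [show ({a₁, b₁, a₂, b₂} : Set V) \ {a₁, b₁} = {a₂, b₂} by grind]
    exact one_le_numMatchingsOn_pair hab'
  · rw [show ({a₁, b₁, a₂, b₂} : Set V) \ {a₁, b₂} = {b₁, a₂} by grind]
    exact one_le_numMatchingsOn_pair hba
  · rw [show ({a₁, b₁, a₂, b₂} : Set V) \ {a₂, b₁} = {b₂, a₁} by grind]
    exact one_le_numMatchingsOn_pair hba'
  · rw [show ({a₁, b₁, a₂, b₂} : Set V) \ {a₂, b₂} = {a₁, b₁} by grind]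
    exact one_le_numMatchingsOn_pair hab

theorem incr (h : IsBalancedNet G C st a₁ a₂ b₁ b₂) (hv : v ∉ st) (hv' : v' ∉ st)
    (hadj : G.Adj v v') (hav : G.Adj a₁ v) (hbv : G.Adj b₁ v') (cv : v ∉ C) (cv' : v' ∈ C) :
    IsBalancedNet G C (st ∪ {v, v'}) a₂ v' b₂ v := by
  obtain ⟨h₁, h₂, h₃, h₄, h₅, h₆, h₇, h₈, h₉, h₁₀, f, e, a, b, c, d, hn, kf, ke, ka, kb, kc, kd⟩ := h
  refine ⟨.inl h₂, .inr (by simp), .inl h₄, .inr (by simp), h₆, cv', h₈, cv, by grind, by grind,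
    f + a, d, d + e, c, b, f, ?_, ?_, ?_, ?_, ?_, ?_, ?_⟩
  · have hcard : (st ∪ {v, v'}).ncard = st.ncard + 2 := by
      rw [Set.ncard_union_eq (by simp [hv, hv']), Set.ncard_pair hadj.ne]
    rw [hcard]
    exact hn.incr
  · have k := numMatchingsOn_add_mul_le (S := st) (T := {v, v'}) (by simp [hv, hv']) hav h₁
      (by simp)
    have k₁ := numMatchingsOn_le_union_pair (S := st \ {a₁, b₁}) hbv (by simp) (by simp [hv'])
    rw [show (st \ {a₁, b₁}) ∪ {b₁, v'} = (st ∪ {v, v'}) \ {a₁, v} by grind] at k₁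
    have k₂ := Nat.mul_le_mul kf (one_le_numMatchingsOn_pair hadj)
    omega
  · rwa [show (st ∪ {v, v'}) \ {a₂, v', b₂, v} = st \ {a₂, b₂} by grind]
  · have k := numMatchingsOn_add_mul_le (S := st \ {a₂, b₂}) (T := {v, v'}) (by simp [hv, hv'])
      hav (by grind) (by simp)
    have k₁ := numMatchingsOn_le_union_pair (S := st \ {a₁, a₂, b₁, b₂}) hbv (by simp)
      (by simp [hv'])
    rw [show (st \ {a₁, a₂, b₁, b₂}) ∪ {b₁, v'} = (st \ {a₂, b₂} ∪ {v, v'}) \ {a₁, v} by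
      grind] at k₁
    have k₂ := Nat.mul_le_mul kd (one_le_numMatchingsOn_pair hadj)
    rw [show (st ∪ {v, v'}) \ {a₂, b₂} = st \ {a₂, b₂} ∪ {v, v'} by grind]
    omega
  · have k₁ := numMatchingsOn_le_union_pair (S := st \ {a₂, b₁}) hbv (by simp) (by simp [hv'])
    rw [show (st \ {a₂, b₁}) ∪ {b₁, v'} = (st ∪ {v, v'}) \ {a₂, v} by grind] at k₁
    exact kc.trans k₁
  · have k₁ := numMatchingsOn_le_union_pair (S := st \ {a₁, b₂}) hav (by simp) (by simp [hv])
    rw [show (st \ {a₁, b₂}) ∪ {a₁, v} = (st ∪ {v, v'}) \ {v', b₂} by grind] at k₁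
    exact kb.trans k₁
  · rwa [show (st ∪ {v, v'}) \ {v', v} = st by grind]

theorem mul_mixed (h : IsBalancedNet G C st a₁ a₂ b₁ b₂)
    (h' : IsBalancedNet G C st' a₁' a₂' b₁' b₂') (hst : Disjoint st st') (hab : G.Adj a₁ b₁')
    (hba : G.Adj b₁ a₁') : IsBalancedNet G C (st ∪ st') a₂ a₂' b₂ b₂' := by
  obtain ⟨h₁, h₂, h₃, h₄, h₅, h₆, h₇, h₈, h₉, h₁₀, f, e, a, b, c, d, hn, kf, ke, ka, kb, kc, kd⟩ := h
  obtain ⟨h₁', h₂', h₃', h₄', h₅', h₆', h₇', h₈', h₉', h₁₀', f', e', a', b', c', d', hn', kf', ke',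
    ka', kb', kc', kd'⟩ := h'
  have hd := Set.disjoint_left.1 hst
  refine ⟨.inl h₂, .inr h₂', .inl h₄, .inr h₄', h₆, h₆', h₈, h₈', by grind, by grind, _, _, _, _,
    _, _, Set.ncard_union_eq hst ▸ hn.mul_mixed hn', ?_, ?_, ?_, ?_, ?_, ?_⟩
  · have k := numMatchingsOn_mul_add_mul_le (S := st) (T := st') hst hab hba h₁ h₃ h₃' h₁'
      (by grind) (by grind)
    rw [Set.pair_comm b₁' a₁'] at k
    have k₁ := Nat.mul_le_mul kf kf'
    have k₂ := Nat.mul_le_mul ka ka'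
    omega
  · have k := numMatchingsOn_mul_add_mul_le (S := st \ {a₂, b₂}) (T := st' \ {a₂', b₂'})
      (hst.mono Set.sdiff_subset Set.sdiff_subset) hab hba (by grind) (by grind) (by grind)
      (by grind) (by grind) (by grind)
    rw [show (st \ {a₂, b₂}) \ {a₁, b₁} = st \ {a₁, a₂, b₁, b₂} by grind,
      show (st' \ {a₂', b₂'}) \ {b₁', a₁'} = st' \ {a₁', a₂', b₁', b₂'} by grind] at k
    rw [show (st ∪ st') \ {a₂, a₂', b₂, b₂'} = st \ {a₂, b₂} ∪ st' \ {a₂', b₂'} by grind]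
    have k₁ := Nat.mul_le_mul kd kd'
    have k₂ := Nat.mul_le_mul ke ke'
    omega
  · have k := numMatchingsOn_mul_add_mul_le (S := st \ {a₂, b₂}) (T := st')
      (hst.mono_left Set.sdiff_subset) hab hba (by grind) (by grind) (by grind)
      (by grind) (by grind) (by grind)
    rw [show (st \ {a₂, b₂}) \ {a₁, b₁} = st \ {a₁, a₂, b₁, b₂} by grind,
      Set.pair_comm b₁' a₁'] at k
    rw [show (st ∪ st') \ {a₂, b₂} = st \ {a₂, b₂} ∪ st' by grind]
    have k₁ := Nat.mul_le_mul kd kf'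
    have k₂ := Nat.mul_le_mul ke ka'
    omega
  · have k := numMatchingsOn_mul_le_edge (S := st \ {a₂, b₁}) (T := st' \ {a₁', b₂'})
      (hst.mono Set.sdiff_subset Set.sdiff_subset) hba (by grind) (by grind)
    rw [show st \ {a₂, b₁} ∪ st' \ {a₁', b₂'} ∪ {b₁, a₁'} = (st ∪ st') \ {a₂, b₂'} by grind] at k
    exact (Nat.mul_le_mul kc kb').trans k
  · have k := numMatchingsOn_mul_le_edge (S := st \ {a₁, b₂}) (T := st' \ {a₂', b₁'})
      (hst.mono Set.sdiff_subset Set.sdiff_subset) hab (by grind) (by grind)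
    rw [show st \ {a₁, b₂} ∪ st' \ {a₂', b₁'} ∪ {a₁, b₁'} = (st ∪ st') \ {a₂', b₂} by grind] at k
    exact (Nat.mul_le_mul kb kc').trans k
  · have k := numMatchingsOn_mul_add_mul_le (S := st) (T := st' \ {a₂', b₂'})
      (hst.mono_right Set.sdiff_subset) hab hba (by grind) (by grind) (by grind)
      (by grind) (by grind) (by grind)
    rw [show (st' \ {a₂', b₂'}) \ {b₁', a₁'} = st' \ {a₁', a₂', b₁', b₂'} by grind] at k
    rw [show (st ∪ st') \ {a₂', b₂'} = st ∪ st' \ {a₂', b₂'} by grind]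
    have k₁ := Nat.mul_le_mul kf kd'
    have k₂ := Nat.mul_le_mul ka ke'
    omega

theorem mul_same (h : IsBalancedNet G C st a₁ a₂ b₁ b₂)
    (h' : IsBalancedNet G C st' a₁' a₂' b₁' b₂') (hst : Disjoint st st') (hab : G.Adj a₁ b₁')
    (hab' : G.Adj a₂ b₂') : IsBalancedNet G C (st ∪ st') a₁' a₂' b₁ b₂ := by
  obtain ⟨h₁, h₂, h₃, h₄, h₅, h₆, h₇, h₈, h₉, h₁₀, f, e, a, b, c, d, hn, kf, ke, ka, kb, kc, kd⟩ := h
  obtain ⟨h₁', h₂', h₃', h₄', h₅', h₆', h₇', h₈', h₉', h₁₀', f', e', a', b', c', d', hn', kf', ke',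
    ka', kb', kc', kd'⟩ := h'
  have hd := Set.disjoint_left.1 hst
  have key : ∀ x ∈ st', x ∈ C → ∀ y ∈ st, y ∉ C →
      numMatchingsOn G (st \ {a₁, y}) * numMatchingsOn G (st' \ {x, b₁'}) +
        numMatchingsOn G (st \ {a₂, y}) * numMatchingsOn G (st' \ {x, b₂'}) ≤
        numMatchingsOn G ((st ∪ st') \ {x, y}) := by
    intro x hx hxC y hy hyC
    have k := numMatchingsOn_mul_add_mul_le' (S := st \ {y}) (T := st' \ {x})
      (hst.mono Set.sdiff_subset Set.sdiff_subset) hab hab' (by grind) (by grind) (by grind)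
      (by grind) (by grind)
    rwa [show st \ {y} ∪ st' \ {x} = (st ∪ st') \ {x, y} by grind,
      show (st \ {y}) \ {a₁} = st \ {a₁, y} by grind,
      show (st \ {y}) \ {a₂} = st \ {a₂, y} by grind,
      show (st' \ {x}) \ {b₁'} = st' \ {x, b₁'} by grind,
      show (st' \ {x}) \ {b₂'} = st' \ {x, b₂'} by grind] at k
  refine ⟨.inr h₁', .inr h₂', .inl h₃, .inl h₄, h₅', h₆', h₇, h₈, h₉', h₁₀, _, _, _, _, _, _,
    Set.ncard_union_eq hst ▸ hn.mul_same hn', ?_, ?_, ?_, ?_, ?_, ?_⟩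
  · exact (Nat.mul_le_mul kf kf').trans (numMatchingsOn_mul_le hst)
  · have k := numMatchingsOn_mul_le_edge (S := st \ {a₁, a₂, b₁, b₂})
      (T := st' \ {a₁', a₂', b₁', b₂'})
      (hst.mono Set.sdiff_subset Set.sdiff_subset) hab (by grind) (by grind)
    have k' := k.trans (numMatchingsOn_le_union_pair hab' (by grind) (by grind))
    rw [show st \ {a₁, a₂, b₁, b₂} ∪ st' \ {a₁', a₂', b₁', b₂'} ∪ {a₁, b₁'} ∪ {a₂, b₂'} =
      (st ∪ st') \ {a₁', a₂', b₁, b₂} by grind] at k'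
    exact (Nat.mul_le_mul ke ke').trans k'
  · exact (by gcongr : _ ≤ _).trans (key a₁' h₁' h₅' b₁ h₃ h₇)
  · exact (by gcongr : _ ≤ _).trans (key a₁' h₁' h₅' b₂ h₄ h₈)
  · exact (by gcongr : _ ≤ _).trans (key a₂' h₂' h₆' b₁ h₃ h₇)
  · exact (by gcongr : _ ≤ _).trans (key a₂' h₂' h₆' b₂ h₄ h₈)

end IsBalancedNet

theorem IsTwistedNet.exists_isBalancedNet [Finite V] {G : SimpleGraph V} {C st c : Set V}
    (h : IsTwistedNet G st c) (hC : ∀ x y, G.Adj x y → (x ∈ C ↔ y ∉ C)) :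
    ∃ a₁ a₂ b₁ b₂, IsBalancedNet G C st a₁ a₂ b₁ b₂ ∧ c = {a₁, a₂, b₁, b₂} := by
  induction h with
  | cyc4 a b c d hab hac had hbc hbd hcd hadj =>
    have k₁ : G.Adj a b := (hadj a (by simp) b (by simp)).2 (by simp)
    have k₂ : G.Adj b c := (hadj b (by simp) c (by simp)).2 (by simp)
    have k₃ : G.Adj c d := (hadj c (by simp) d (by simp)).2 (by simp)
    have k₄ : G.Adj d a := (hadj d (by simp) a (by simp)).2 (by simp)
    have c₁ := hC a b k₁
    have c₂ := hC b c k₂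
    have c₃ := hC c d k₃
    by_cases ha : a ∈ C
    · exact ⟨a, c, b, d, .four_cycle k₁ k₂ k₃ k₄ hac hbd ha (by tauto) (by tauto) (by tauto),
        by clear hadj hC; grind⟩
    · refine ⟨b, d, c, a, ?_, by clear hadj hC; grind⟩
      rw [show ({a, b, c, d} : Set V) = {b, c, d, a} by clear hadj hC; grind]
      exact .four_cycle k₂ k₃ k₄ k₁ hbd hac.symm (by tauto) (by tauto) (by tauto) ha
  | incr st c u u' v v' hprev hu hu' huu' hv hv' hvv' hvv'adj huv hu'v' hcross ih =>
    obtain ⟨a₁, a₂, b₁, b₂, ih, rfl⟩ := ih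
    have c₁ := hC _ _ huv
    have c₂ := hC _ _ hu'v'
    have c₃ := hC _ _ hvv'adj
    by_cases huC : u ∈ C
    · obtain ⟨a, b, h, e⟩ := ih.exists_mixed hu huC hu' (by tauto)
      have h' := h.incr hv hv' hvv'adj huv hu'v' (by tauto) (by tauto)
      refine ⟨_, _, _, _, h', ?_⟩
      have := h.ne_a
      have := h.ne_b
      have : a ≠ u' := fun h₀ => h.cb₁ (h₀ ▸ h.ca₂)
      have : b ≠ u := fun h₀ => h.cb₂ (h₀ ▸ h.ca₁)
      grind
    · obtain ⟨a, b, h, e⟩ := ih.exists_mixed hu' (by tauto) hu huC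
      have h' := h.incr hv' hv hvv'adj.symm hu'v' huv (by tauto) (by tauto)
      rw [Set.pair_comm v v']
      refine ⟨_, _, _, _, h', ?_⟩
      have := h.ne_a
      have := h.ne_b
      have : a ≠ u := fun h₀ => h.cb₁ (h₀ ▸ h.ca₂)
      have : b ≠ u' := fun h₀ => h.cb₂ (h₀ ▸ h.ca₁)
      grind
  | mult st₁ c₁ st₂ c₂ u u' v v' _ _ hdisj hu hu' huu' hv hv' hvv' huv hu'v' hcross ih₁ ih₂ =>
    obtain ⟨a₁, a₂, b₁, b₂, ih₁, rfl⟩ := ih₁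
    obtain ⟨a₁', a₂', b₁', b₂', ih₂, rfl⟩ := ih₂
    have hst : Disjoint st₁ st₂ := Set.disjoint_iff_inter_eq_empty.2 hdisj
    have k₁ := hC _ _ huv
    have k₂ := hC _ _ hu'v'
    by_cases huC : u ∈ C <;> by_cases huC' : u' ∈ C
    · obtain ⟨h, e⟩ := ih₁.exists_both_left hu huC hu' huC' huu'
      obtain ⟨h', e'⟩ := ih₂.exists_both_right hv (by tauto) hv' (by tauto) hvv'
      refine ⟨_, _, _, _, h.mul_same h' hst huv hu'v', ?_⟩
      obtain ⟨-, -, -, -, _, _, _, _, _, _, -⟩ := h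
      obtain ⟨-, -, -, -, _, _, _, _, _, _, -⟩ := h'
      rw [e, e']
      clear hcross hC hst hdisj hu hu' hv hv' e e' ih₁ ih₂ k₁ k₂
      grind
    · obtain ⟨a, b, h, e⟩ := ih₁.exists_mixed hu huC hu' huC'
      obtain ⟨a', b', h', e'⟩ := ih₂.exists_mixed hv' (by tauto) hv (by tauto)
      refine ⟨_, _, _, _, h.mul_mixed h' hst huv hu'v', ?_⟩
      obtain ⟨-, -, -, -, _, _, _, _, _, _, -⟩ := h
      obtain ⟨-, -, -, -, _, _, _, _, _, _, -⟩ := h'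
      rw [e, e']
      clear hcross hC hst hdisj hu hu' hv hv' e e' ih₁ ih₂ k₁ k₂
      grind
    · obtain ⟨a, b, h, e⟩ := ih₁.exists_mixed hu' huC' hu huC
      obtain ⟨a', b', h', e'⟩ := ih₂.exists_mixed hv (by tauto) hv' (by tauto)
      refine ⟨_, _, _, _, h.mul_mixed h' hst hu'v' huv, ?_⟩
      obtain ⟨-, -, -, -, _, _, _, _, _, _, -⟩ := h
      obtain ⟨-, -, -, -, _, _, _, _, _, _, -⟩ := h'
      rw [e, e']
      clear hcross hC hst hdisj hu hu' hv hv' e e' ih₁ ih₂ k₁ k₂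
      grind
    · obtain ⟨h, e⟩ := ih₁.exists_both_right hu huC hu' huC' huu'
      obtain ⟨h', e'⟩ := ih₂.exists_both_left hv (by tauto) hv' (by tauto) hvv'
      rw [Set.union_comm st₁]
      refine ⟨_, _, _, _, h'.mul_same h hst.symm huv.symm hu'v'.symm, ?_⟩
      obtain ⟨-, -, -, -, _, _, _, _, _, _, -⟩ := h
      obtain ⟨-, -, -, -, _, _, _, _, _, _, -⟩ := h'
      rw [e, e']
      clear hcross hC hst hdisj hu hu' hv hv' e e' ih₁ ih₂ k₁ k₂
      grind

theorem rpow_le_of_two_pow_le {n m : ℕ} (h : 2 ^ n ≤ 16 * m ^ 18) :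
    (2 : ℝ) ^ ((n : ℝ) / 18 - 2 / 9) ≤ m := by
  have h' : (2 : ℝ) ^ n ≤ 16 * (m : ℝ) ^ 18 := by exact_mod_cast h
  refine le_of_pow_le_pow_left₀ (n := 18) (by norm_num) (Nat.cast_nonneg m) ?_
  rw [← Real.rpow_natCast, ← Real.rpow_mul two_pos.le,
    show ((n : ℝ) / 18 - 2 / 9) * (18 : ℕ) = n - (4 : ℕ) by push_cast; ring,
    Real.rpow_sub two_pos, Real.rpow_natCast, Real.rpow_natCast, div_le_iff₀ (by norm_num)]
  linarith

theorem exists_dominating_entry (a b c d : ℕ) :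
    (a ≤ a ∧ b ≤ a ∧ c ≤ a ∧ d ≤ a) ∨ (a ≤ b ∧ b ≤ b ∧ c ≤ b ∧ d ≤ b) ∨
      (a ≤ c ∧ b ≤ c ∧ c ≤ c ∧ d ≤ c) ∨ (a ≤ d ∧ b ≤ d ∧ c ≤ d ∧ d ≤ d) := by
  omega

/-- Bipartite twisted nets: a bipartite twisted net `G` with `n` vertices has two
corners `u₁, u₂` in one color class and two corners `v₁, v₂` in the other; `G` minus
all four corners has a perfect matching; each `G \ {u_i, v_j}` has a perfect matching;
and for some `i, j`, the graph `G \ {u_i, v_j}` has at least `2^(n/18 - 2/9)` perfect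
matchings. -/
theorem bipartite_twisted_net_matchings
    [Fintype V] (G : SimpleGraph V) (c : Set V)
    (h : IsTwistedNet G Set.univ c)
    (hbip : ∃ C : Set V, ∀ x y, G.Adj x y → (x ∈ C ↔ y ∉ C)) :
    ∃ (u₁ u₂ v₁ v₂ : V) (C : Set V),
      (∀ x y, G.Adj x y → (x ∈ C ↔ y ∉ C)) ∧
      c = {u₁, u₂, v₁, v₂} ∧ u₁ ≠ u₂ ∧ v₁ ≠ v₂ ∧
      u₁ ∈ C ∧ u₂ ∈ C ∧ v₁ ∉ C ∧ v₂ ∉ C ∧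
      (∃ M, IsNearPM G Set.univ {u₁, u₂, v₁, v₂} M) ∧
      (∀ u ∈ ({u₁, u₂} : Set V), ∀ v ∈ ({v₁, v₂} : Set V),
        ∃ M, IsNearPM G Set.univ {u, v} M) ∧
      (∃ u ∈ ({u₁, u₂} : Set V), ∃ v ∈ ({v₁, v₂} : Set V),
        (2 : ℝ) ^ ((Fintype.card V : ℝ) / 18 - 2 / 9) ≤
          ({M : Set (Sym2 V) | IsNearPM G Set.univ {u, v} M}.ncard : ℝ)) := by
  obtain ⟨C, hC⟩ := hbip
  obtain ⟨u₁, u₂, v₁, v₂, hnet, rfl⟩ := h.exists_isBalancedNet hC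
  obtain ⟨-, -, -, -, h₅, h₆, h₇, h₈, h₉, h₁₀, f, e, a, b, c, d, hn, -, ke, ka, kb, kc, kd⟩ := hnet
  have exists_of_pos : ∀ {X : Set V} {k : ℕ}, 0 < k → k ≤ numMatchingsOn G (Set.univ \ X) →
      ∃ M, IsNearPM G Set.univ X M := by
    intro X k hk hkX
    obtain ⟨M, hM⟩ := (Set.ncard_pos).1 (hk.trans_le hkX)
    exact ⟨M, (isNearPM_iff_isMatchingOn ..).2 hM⟩
  refine ⟨u₁, u₂, v₁, v₂, C, hC, rfl, h₉, h₁₀, h₅, h₆, h₇, h₈, exists_of_pos hn.e_pos ke, ?_, ?_⟩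
  · rintro u (rfl | rfl) v (rfl | rfl)
    exacts [exists_of_pos hn.pos₁₁ ka, exists_of_pos hn.pos₁₂ kb, exists_of_pos hn.pos₂₁ kc,
      exists_of_pos hn.pos₂₂ kd]
  · have large : ∀ {X : Set V} {k : ℕ}, k ≤ numMatchingsOn G (Set.univ \ X) →
        a ≤ k ∧ b ≤ k ∧ c ≤ k ∧ d ≤ k → (2 : ℝ) ^ ((Fintype.card V : ℝ) / 18 - 2 / 9) ≤
          ({M : Set (Sym2 V) | IsNearPM G Set.univ X M}.ncard : ℝ) := by
      rintro X k hkX ⟨k₁, k₂, k₃, k₄⟩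
      have hp := hn.two_pow_le_of_le k₁ k₂ k₃ k₄
      rw [Set.ncard_univ, Nat.card_eq_fintype_card] at hp
      refine (rpow_le_of_two_pow_le hp).trans ?_
      simp_rw [isNearPM_iff_isMatchingOn]
      exact_mod_cast hkX
    rcases exists_dominating_entry a b c d with hm | hm | hm | hm
    exacts [⟨u₁, by simp, v₁, by simp, large ka hm⟩, ⟨u₁, by simp, v₂, by simp, large kb hm⟩,
      ⟨u₂, by simp, v₁, by simp, large kc hm⟩, ⟨u₂, by simp, v₂, by simp, large kd hm⟩]
end
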